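/- arXiv:1912.04600 — 2 statements merged into one kernel-verified Lean document; each statement's English description precedes it below -/
import Mathlib

section
/- Every primitive triple of integers (x, y, z) satisfying x³ + 7y³ = 262193⁴ · z⁷ satisfies x ≡ y ≡ 0 (mod 262193). -/
open Polynomial NumberField

theorem minpoly_eq_of_isEisensteinAt {K : Type*} [Field K] [CharZero K] {p : ℤ} (hp : Prime p)
    {f : ℤ[X]} (hf : f.Monic) (hf0 : 0 < f.natDegree)
    (hE : f.IsEisensteinAt (Submodule.span ℤ {p})) {t : K} (ht : aeval t f = 0) :
    minpoly ℤ t = f := by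
  have hint : IsIntegral ℤ t := ⟨f, hf, by simpa [aeval_def] using ht⟩
  have hirr : Irreducible f :=
    hE.irreducible ((Ideal.span_singleton_prime hp.ne_zero).2 hp) hf.isPrimitive hf0
  have hdvd : minpoly ℤ t ∣ f := minpoly.isIntegrallyClosed_dvd hint ht
  exact eq_of_monic_of_associated (minpoly.monic hint) hf
    ((minpoly.irreducible hint).associated_of_dvd hirr hdvd)

theorem exists_powerBasis_gen_eq {K : Type*} [Field K] [NumberField K] {t : K}
    (h : (minpoly ℚ t).natDegree = Module.finrank ℚ K) : ∃ B : PowerBasis ℚ K, B.gen = t := by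
  have hint : IsIntegral ℚ t := Algebra.IsIntegral.isIntegral t
  have htop : Algebra.adjoin ℚ {t} = ⊤ := by
    have := (Field.primitive_element_iff_minpoly_natDegree_eq ℚ t).2 h
    rw [← IntermediateField.adjoin_simple_toSubalgebra_of_isAlgebraic hint.isAlgebraic, this]
    rfl
  exact ⟨PowerBasis.ofAdjoinEqTop hint htop, PowerBasis.ofAdjoinEqTop_gen hint htop⟩

theorem isEisensteinAt_X_pow_three_sub_seven :
    (X ^ 3 - C 7 : ℤ[X]).IsEisensteinAt (Submodule.span ℤ {7}) := by
  have hd : (X ^ 3 - C 7 : ℤ[X]).natDegree = 3 := by compute_degree!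
  refine ⟨?_, fun {n} hn => ?_, ?_⟩
  · rw [(by monicity! : (X ^ 3 - C 7 : ℤ[X]).Monic).leadingCoeff]
    simp [Ideal.submodule_span_eq, Ideal.mem_span_singleton]
  · rw [hd] at hn
    rw [Ideal.submodule_span_eq, Ideal.mem_span_singleton]
    interval_cases n <;> simp [coeff_X_pow]
  · rw [Ideal.submodule_span_eq, Ideal.span_singleton_pow, Ideal.mem_span_singleton]
    simp [coeff_X_pow]

theorem isEisensteinAt_X_add_one_pow_three_sub_seven :
    (X ^ 3 + C 3 * X ^ 2 + C 3 * X - C 6 : ℤ[X]).IsEisensteinAt (Submodule.span ℤ {3}) := by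
  have hd : (X ^ 3 + C 3 * X ^ 2 + C 3 * X - C 6 : ℤ[X]).natDegree = 3 := by compute_degree!
  refine ⟨?_, fun {n} hn => ?_, ?_⟩
  · rw [(by monicity! : (X ^ 3 + C 3 * X ^ 2 + C 3 * X - C 6 : ℤ[X]).Monic).leadingCoeff]
    simp [Ideal.submodule_span_eq, Ideal.mem_span_singleton]
  · rw [hd] at hn
    rw [Ideal.submodule_span_eq, Ideal.mem_span_singleton]
    interval_cases n <;> simp [coeff_X, coeff_X_pow]
  · rw [Ideal.submodule_span_eq, Ideal.span_singleton_pow, Ideal.mem_span_singleton]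
    simp [coeff_X_pow]

theorem isIntegral_of_pow_three_eq_seven {K : Type*} [Field K] {t : K} (ht : t ^ 3 = 7) :
    IsIntegral ℤ t :=
  IsIntegral.of_pow (n := 3) (by norm_num) (by
    rw [ht]; simpa using isIntegral_algebraMap (R := ℤ) (A := K) (x := 7))

section
variable {K : Type*} [Field K] [NumberField K] {t : K}

theorem minpoly_int_of_pow_three_eq_seven (ht : t ^ 3 = 7) : minpoly ℤ t = X ^ 3 - C 7 :=
  minpoly_eq_of_isEisensteinAt (p := 7) (by norm_num) (by monicity!)
    (by rw [show (X ^ 3 - C 7 : ℤ[X]).natDegree = 3 by compute_degree!]; norm_num)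
    isEisensteinAt_X_pow_three_sub_seven
    (by simp only [map_sub, map_pow, aeval_X, aeval_C, ht]; simp)

theorem minpoly_int_sub_one_of_pow_three_eq_seven (ht : t ^ 3 = 7) :
    minpoly ℤ (t - 1) = X ^ 3 + C 3 * X ^ 2 + C 3 * X - C 6 :=
  minpoly_eq_of_isEisensteinAt (p := 3) (by norm_num) (by monicity!)
    (by rw [show (X ^ 3 + C 3 * X ^ 2 + C 3 * X - C 6 : ℤ[X]).natDegree = 3 by compute_degree!]
        norm_num)
    isEisensteinAt_X_add_one_pow_three_sub_seven (by
      simp only [map_sub, map_add, map_mul, map_pow, aeval_X, aeval_C, algebraMap_int_eq]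
      simp only [eq_intCast]
      push_cast
      linear_combination ht)

theorem minpoly_rat_of_pow_three_eq_seven (ht : t ^ 3 = 7) : minpoly ℚ t = X ^ 3 - C 7 := by
  rw [minpoly.isIntegrallyClosed_eq_field_fractions' ℚ (isIntegral_of_pow_three_eq_seven ht),
    minpoly_int_of_pow_three_eq_seven ht]
  simp only [Polynomial.map_sub, Polynomial.map_pow, map_X, map_C]
  rfl

theorem discr_powerBasis_of_pow_three_eq_seven (h3 : Module.finrank ℚ K = 3) (ht : t ^ 3 = 7)
    (B : PowerBasis ℚ K) (hB : B.gen = t) : Algebra.discr ℚ B.basis = -1323 := by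
  have hm := minpoly_rat_of_pow_three_eq_seven ht
  have hN : Algebra.norm ℚ t = 7 := by
    have hd : B.dim = 3 := by rw [← B.finrank, h3]
    rw [← hB, Algebra.PowerBasis.norm_gen_eq_coeff_zero_minpoly, hB, hm, hd]
    norm_num
  rw [Algebra.discr_powerBasis_eq_norm, hB, hm, h3]
  have : aeval t (derivative (X ^ 3 - C 7 : ℚ[X])) = algebraMap ℚ K 3 * t ^ 2 := by
    simp only [derivative_X_pow, derivative_C, map_sub, map_mul, map_pow, aeval_X,
      aeval_C, sub_zero]
    norm_num
  rw [this, map_mul, map_pow, hN, Algebra.norm_algebraMap, h3]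
  norm_num

theorem mem_adjoin_of_pow_three_eq_seven (h3 : Module.finrank ℚ K = 3) (ht : t ^ 3 = 7) {z : K}
    (hz : IsIntegral ℤ z) : z ∈ Algebra.adjoin ℤ {t} := by
  have hint := isIntegral_of_pow_three_eq_seven ht
  have hint1 : IsIntegral ℤ (t - 1) := hint.sub isIntegral_one
  obtain ⟨B, hB⟩ := exists_powerBasis_gen_eq (t := t) (by
    rw [minpoly_rat_of_pow_three_eq_seven ht, h3]; compute_degree!)
  obtain ⟨B1, hB1⟩ := exists_powerBasis_gen_eq (t := t - 1) (by
    rw [minpoly.isIntegrallyClosed_eq_field_fractions' ℚ hint1,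
      minpoly_int_sub_one_of_pow_three_eq_seven ht, h3, (by monicity! : Polynomial.Monic
        (X ^ 3 + C 3 * X ^ 2 + C 3 * X - C 6 : ℤ[X])).natDegree_map]
    compute_degree!)
  have hadj : Algebra.adjoin ℤ {t} ≤ Algebra.adjoin ℤ {t - 1} :=
    Algebra.adjoin_le (by
      simpa using add_mem (Algebra.self_mem_adjoin_singleton ℤ (t - 1)) (one_mem _))
  have hadj' : Algebra.adjoin ℤ {t - 1} ≤ Algebra.adjoin ℤ {t} :=
    Algebra.adjoin_le (by
      simpa using sub_mem (Algebra.self_mem_adjoin_singleton ℤ t) (one_mem _))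
  have hdisc := Algebra.discr_mul_isIntegral_mem_adjoin ℚ (hB ▸ hint) hz
  rw [discr_powerBasis_of_pow_three_eq_seven h3 ht B hB, hB] at hdisc
  have h7 : (27 : ℤ) • z ∈ Algebra.adjoin ℤ {t} := by
    have := mem_adjoin_of_smul_prime_pow_smul_of_minpoly_isEisensteinAt (R := ℤ) (K := ℚ) (B := B)
      (p := 7) (n := 2) (z := (27 : ℤ) • z) (by norm_num) (hB ▸ hint) (hz.smul _)
      (by
        rw [hB]
        convert neg_mem hdisc using 1
        simp only [Algebra.smul_def]
        push_cast
        simp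
        ring)
      (by rw [hB, minpoly_int_of_pow_three_eq_seven ht]; exact isEisensteinAt_X_pow_three_sub_seven)
    rwa [hB] at this
  have := mem_adjoin_of_smul_prime_pow_smul_of_minpoly_isEisensteinAt (R := ℤ) (K := ℚ) (B := B1)
      (p := 3) (n := 3) (z := z) (by norm_num) (hB1 ▸ hint1) hz
      (by rw [hB1]; exact hadj h7)
      (by rw [hB1, minpoly_int_sub_one_of_pow_three_eq_seven ht]
          exact isEisensteinAt_X_add_one_pow_three_sub_seven)
  rw [hB1] at this
  exact hadj' this

end

section
variable {K : Type*} [Field K] [NumberField K] {θ : 𝓞 K}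

theorem adjoin_eq_top_of_pow_three_eq_seven (h3 : Module.finrank ℚ K = 3) (hθ : θ ^ 3 = 7) :
    Algebra.adjoin ℤ {θ} = ⊤ := by
  have ht : (θ : K) ^ 3 = 7 := by
    have := congrArg (algebraMap (𝓞 K) K) hθ
    rwa [map_pow, map_ofNat] at this
  refine eq_top_iff.2 fun z _ => ?_
  have hz := mem_adjoin_of_pow_three_eq_seven h3 ht (RingOfIntegers.isIntegral_coe z)
  have hmap : (Algebra.adjoin ℤ {θ}).map (IsScalarTower.toAlgHom ℤ (𝓞 K) K) =
      Algebra.adjoin ℤ {(θ : K)} := by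
    rw [AlgHom.map_adjoin, Set.image_singleton]; rfl
  rw [← hmap] at hz
  obtain ⟨w, hw, hwz⟩ := hz
  rwa [← RingOfIntegers.coe_injective hwz]

theorem exists_powerBasis_int_of_pow_three_eq_seven (h3 : Module.finrank ℚ K = 3)
    (hθ : θ ^ 3 = 7) : ∃ B : PowerBasis ℤ (𝓞 K), B.gen = θ :=
  ⟨PowerBasis.ofAdjoinEqTop' θ.isIntegral (adjoin_eq_top_of_pow_three_eq_seven h3 hθ),
    PowerBasis.ofAdjoinEqTop'_gen _ _⟩

theorem discr_of_pow_three_eq_seven (h3 : Module.finrank ℚ K = 3) (hθ : θ ^ 3 = 7) :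
    discr K = -1323 := by
  have ht : (θ : K) ^ 3 = 7 := by
    have := congrArg (algebraMap (𝓞 K) K) hθ
    rwa [map_pow, map_ofNat] at this
  obtain ⟨B, hB⟩ := exists_powerBasis_int_of_pow_three_eq_seven h3 hθ
  let B' : PowerBasis ℚ K :=
    { gen := θ, dim := B.dim, basis := B.basis.localizationLocalization ℚ (nonZeroDivisors ℤ) K
      basis_eq_pow := fun i => by
        rw [Module.Basis.localizationLocalization_apply, B.basis_eq_pow, hB, map_pow] }
  have h1 := discr_powerBasis_of_pow_three_eq_seven h3 ht B' rfl
  have h2 : Algebra.discr ℚ (B.basis.localizationLocalization ℚ (nonZeroDivisors ℤ) K) =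
      algebraMap ℤ ℚ (Algebra.discr ℤ B.basis) :=
    Algebra.discr_localizationLocalization ℤ (nonZeroDivisors ℤ) K B.basis
  rw [NumberField.discr_eq_discr] at h2
  have h4 : (discr K : ℚ) = -1323 := by
    rw [← h1]; exact h2.symm
  exact_mod_cast h4
end

section
variable {R : Type*} [CommRing R]

theorem span_pair_pow_three {a b d : R} (s t : R) (h : d = s * a ^ 3 + t * b ^ 3)
    (h0 : d ∣ a ^ 3) (h1 : d ∣ a ^ 2 * b) (h2 : d ∣ a * b ^ 2) (h3 : d ∣ b ^ 3) :
    Ideal.span {a, b} ^ 3 = Ideal.span {d} := by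
  have ha : a ∈ Ideal.span {a, b} := Ideal.subset_span (by simp)
  have hb : b ∈ Ideal.span {a, b} := Ideal.subset_span (by simp)
  refine le_antisymm ?_ ?_
  · rw [pow_succ, pow_two, Ideal.span_pair_mul_span_pair, Ideal.span_mul_span', Ideal.span_le]
    rintro _ ⟨x, hx, y, hy, rfl⟩
    rw [SetLike.mem_coe, Ideal.mem_span_singleton]
    simp only [Set.mem_insert_iff, Set.mem_singleton_iff] at hx hy
    rcases hx with rfl | rfl | rfl | rfl <;> rcases hy with rfl | rfl <;> ring_nf <;>
      ring_nf at h0 h1 h2 h3 <;> first | assumption | (rw [mul_comm]; assumption)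
  · rw [Ideal.span_singleton_le_iff_mem, h]
    exact add_mem (Ideal.mul_mem_left _ _ (Ideal.pow_mem_pow ha 3))
      (Ideal.mul_mem_left _ _ (Ideal.pow_mem_pow hb 3))

theorem span_pair_pow_seven {β γ z : R} (h : β * γ = z ^ 7) (hc : IsCoprime β γ) :
    Ideal.span {β, z} ^ 7 = Ideal.span {β} := by
  have hβ : β ∈ Ideal.span {β, z} := Ideal.subset_span (by simp)
  have hz : z ∈ Ideal.span {β, z} := Ideal.subset_span (by simp)
  refine le_antisymm ?_ ?_
  · have hmk : Ideal.Quotient.mk (Ideal.span {β}) β = 0 :=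
      Ideal.Quotient.eq_zero_iff_mem.2 (Ideal.mem_span_singleton_self β)
    rw [← Ideal.mk_ker (I := Ideal.span {β}), ← Ideal.map_eq_bot_iff_le_ker, Ideal.map_pow,
      Ideal.map_span, Set.image_pair, hmk, Ideal.span_insert_zero, Ideal.span_singleton_pow,
      ← map_pow, ← h, map_mul, hmk, zero_mul, Ideal.span_singleton_eq_bot.2 rfl]
  · obtain ⟨a, b, hab⟩ := hc.pow_left (m := 6)
    rw [Ideal.span_singleton_le_iff_mem]
    have hβ' : β = a * β ^ 7 + b * z ^ 7 := by linear_combination (-β) * hab + b * h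
    generalize hI : Ideal.span {β, z} = I at hβ hz ⊢
    rw [hβ']
    exact add_mem (Ideal.mul_mem_left _ _ (Ideal.pow_mem_pow hβ 7))
      (Ideal.mul_mem_left _ _ (Ideal.pow_mem_pow hz 7))

theorem dvd_of_intCast_mem {Q : Ideal R} [hQ : Q.IsPrime] {l : ℕ} (hl : l.Prime)
    (hlQ : (l : R) ∈ Q) {n : ℤ} (hn : (n : R) ∈ Q) : (l : ℤ) ∣ n := by
  by_contra hd
  obtain ⟨a, b, hab⟩ := (Nat.prime_iff_prime_int.1 hl).coprime_iff_not_dvd.2 hd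
  refine hQ.ne_top ((Ideal.eq_top_iff_one _).2 ?_)
  have : (1 : R) = a * (l : R) + b * n := by exact_mod_cast congrArg (Int.cast (R := R)) hab.symm
  rw [this]
  exact add_mem (Ideal.mul_mem_left _ _ hlQ) (Ideal.mul_mem_left _ _ hn)

theorem exists_int_sub_mem_of_adjoin_eq_top {θ : R} (hθ : Algebra.adjoin ℤ {θ} = ⊤) {A : Ideal R}
    {r : ℤ} (hr : θ - r ∈ A) (z : R) : ∃ n : ℤ, z - n ∈ A := by
  have hz : z ∈ Algebra.adjoin ℤ {θ} := hθ ▸ Algebra.mem_top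
  induction hz using Algebra.adjoin_induction with
  | mem x hx => rw [Set.mem_singleton_iff.1 hx]; exact ⟨r, hr⟩
  | algebraMap n => exact ⟨n, by simp⟩
  | add x y _ _ hx hy =>
    obtain ⟨m, hm⟩ := hx
    obtain ⟨n, hn⟩ := hy
    refine ⟨m + n, ?_⟩
    convert add_mem hm hn using 1
    push_cast; ring
  | mul x y _ _ hx hy =>
    obtain ⟨m, hm⟩ := hx
    obtain ⟨n, hn⟩ := hy
    refine ⟨m * n, ?_⟩
    convert add_mem (Ideal.mul_mem_left _ y hm) (Ideal.mul_mem_left _ (m : R) hn) using 1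
    push_cast; ring

theorem exists_linear_sub_mem_of_adjoin_eq_top {θ : R} (hθ : Algebra.adjoin ℤ {θ} = ⊤)
    {A : Ideal R} {s t : ℤ} (hst : θ ^ 2 + s * θ + t ∈ A) (z : R) :
    ∃ m n : ℤ, z - (m + n * θ) ∈ A := by
  have hz : z ∈ Algebra.adjoin ℤ {θ} := hθ ▸ Algebra.mem_top
  induction hz using Algebra.adjoin_induction with
  | mem x hx => rw [Set.mem_singleton_iff.1 hx]; exact ⟨0, 1, by simp⟩
  | algebraMap n => exact ⟨n, 0, by simp⟩
  | add x y _ _ hx hy =>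
    obtain ⟨m, n, hm⟩ := hx
    obtain ⟨m', n', hn⟩ := hy
    refine ⟨m + m', n + n', ?_⟩
    convert add_mem hm hn using 1
    push_cast; ring
  | mul x y _ _ hx hy =>
    obtain ⟨m, n, hm⟩ := hx
    obtain ⟨m', n', hn⟩ := hy
    refine ⟨m * m' - n * n' * t, m * n' + n * m' - n * n' * s, ?_⟩
    convert add_mem (add_mem (Ideal.mul_mem_left _ y hm)
      (Ideal.mul_mem_left _ (m + n * θ : R) hn)) (Ideal.mul_mem_left _ (n * n' : R) hst) using 1
    push_cast; ring

theorem eq_span_of_linear_mem {θ : R} (hθ : Algebra.adjoin ℤ {θ} = ⊤) {Q : Ideal R} [Q.IsPrime]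
    {l : ℕ} (hl : l.Prime) (hlQ : (l : R) ∈ Q) {r : ℤ} (hr : θ - r ∈ Q) :
    Q = Ideal.span {(l : R), θ - r} := by
  have hle : Ideal.span {(l : R), θ - r} ≤ Q := by
    rw [Ideal.span_le]; rintro x (rfl | rfl) <;> assumption
  refine le_antisymm (fun z hz => ?_) hle
  obtain ⟨n, hn⟩ := exists_int_sub_mem_of_adjoin_eq_top hθ
    (r := r) (A := Ideal.span {(l : R), θ - r}) (Ideal.subset_span (by simp)) z
  have hnQ : (n : R) ∈ Q := by simpa using sub_mem hz (hle hn)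
  obtain ⟨k, rfl⟩ := dvd_of_intCast_mem hl hlQ hnQ
  have : ((l * k : ℤ) : R) ∈ Ideal.span {(l : R), θ - r} := by
    push_cast; exact Ideal.mul_mem_right _ _ (Ideal.subset_span (by simp))
  simpa using add_mem hn this

theorem eq_span_of_quadratic_mem {θ : R} (hθ : Algebra.adjoin ℤ {θ} = ⊤) {Q : Ideal R}
    [hQ : Q.IsPrime] {l : ℕ} (hl : l.Prime) (hlQ : (l : R) ∈ Q) (hlin : ∀ r : ℤ, θ - r ∉ Q)
    {s t : ℤ} (hst : θ ^ 2 + s * θ + t ∈ Q) :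
    Q = Ideal.span {(l : R), θ ^ 2 + s * θ + t} := by
  have hle : Ideal.span {(l : R), θ ^ 2 + s * θ + t} ≤ Q := by
    rw [Ideal.span_le]; rintro x (rfl | rfl) <;> assumption
  refine le_antisymm (fun z hz => ?_) hle
  have hlA : (l : R) ∈ Ideal.span {(l : R), θ ^ 2 + s * θ + t} := Ideal.subset_span (by simp)
  obtain ⟨m, n, hmn⟩ := exists_linear_sub_mem_of_adjoin_eq_top hθ
    (s := s) (t := t)
    (A := Ideal.span {(l : R), θ ^ 2 + s * θ + t}) (Ideal.subset_span (by simp)) z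
  have hmnQ : (m + n * θ : R) ∈ Q := by simpa using sub_mem hz (hle hmn)
  have hn : (l : ℤ) ∣ n := by
    by_contra hd
    obtain ⟨a, b, hab⟩ := (Nat.prime_iff_prime_int.1 hl).coprime_iff_not_dvd.2 hd
    have hab' : a * (l : R) + b * n = 1 := by exact_mod_cast congrArg (Int.cast (R := R)) hab
    refine hlin (-(b * m)) ?_
    convert add_mem (Ideal.mul_mem_left _ (b : R) hmnQ) (Ideal.mul_mem_left _ (a * θ) hlQ) using 1
    push_cast
    linear_combination (-θ) * hab'
  obtain ⟨k, rfl⟩ := hn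
  have hm : (m : R) ∈ Q := by
    have := sub_mem hmnQ (Ideal.mul_mem_right (k * θ : R) _ hlQ)
    convert this using 1
    push_cast; ring
  obtain ⟨j, rfl⟩ := dvd_of_intCast_mem hl hlQ hm
  have := add_mem hmn (Ideal.mul_mem_right (j + k * θ : R) _ hlA)
  convert this using 1
  push_cast; ring

theorem exists_prime_pow_three_eq_span {θ : R} (hadj : Algebra.adjoin ℤ {θ} = ⊤) (hθ : θ ^ 3 = 7)
    {Q : Ideal R} [hQ : Q.IsPrime] {l : ℕ} (hl : l = 2 ∨ l = 3 ∨ l = 5 ∨ l = 7)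
    (hlQ : (l : R) ∈ Q) : ∃ d, Q ^ 3 = Ideal.span {d} := by
  have hlp : l.Prime := by rcases hl with rfl | rfl | rfl | rfl <;> norm_num
  have key : ∀ r : ℤ, (l : ℤ) ∣ r ^ 3 - 7 → θ - r ∉ Q →
      θ ^ 2 + (r : ℤ) * θ + (r ^ 2 : ℤ) ∈ Q := by
    rintro r ⟨k, hk⟩ hr
    refine (hQ.mem_or_mem ?_).resolve_left hr
    have hk' : (r : R) ^ 3 - 7 = l * k := by exact_mod_cast congrArg (Int.cast (R := R)) hk
    have : (θ - r) * (θ ^ 2 + (r : ℤ) * θ + (r ^ 2 : ℤ)) = l * (-k) := by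
      push_cast
      linear_combination hθ - hk'
    rw [this]
    exact Ideal.mul_mem_right _ _ hlQ
  have cube_mem : ∀ {x : R} (y : R), x ^ 3 = l * y → x ∈ Q := fun {x} y h =>
    hQ.mem_of_pow_mem 3 (h ▸ Ideal.mul_mem_right _ _ hlQ)
  have hlin_cast : ∀ {r r' : ℤ}, (l : ℤ) ∣ r' - r → θ - r' ∈ Q → θ - r ∈ Q := by
    rintro r r' ⟨k, hk⟩ h
    have hk' : (r' : R) - r = l * k := by exact_mod_cast congrArg (Int.cast (R := R)) hk
    convert add_mem h (Ideal.mul_mem_right (k : R) _ hlQ) using 1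
    linear_combination hk'
  have hlin : ∀ {r : ℤ}, (∀ a : ZMod l, a ^ 3 = 7 → a = r) → θ - r ∉ Q → ∀ r' : ℤ, θ - r' ∉ Q := by
    intro r hr hrQ r' hr'
    refine hrQ (hlin_cast ?_ hr')
    rw [← ZMod.intCast_eq_intCast_iff_dvd_sub]
    refine (hr _ ?_).symm
    have : ((r' ^ 3 - 7 : ℤ) : R) ∈ Q := by
      have := Ideal.mul_mem_right (-(θ ^ 2 + θ * r' + (r' : R) ^ 2)) Q hr'
      convert this using 1
      push_cast
      linear_combination hθ
    have := (ZMod.intCast_zmod_eq_zero_iff_dvd _ l).2 (dvd_of_intCast_mem hlp hlQ this)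
    push_cast at this
    exact sub_eq_zero.1 this
  rcases hl with rfl | rfl | rfl | rfl
  · by_cases h : θ - (1 : ℤ) ∈ Q
    · refine ⟨1 + θ, ?_⟩
      rw [eq_span_of_linear_mem hadj hlp hlQ h]
      push_cast
      exact span_pair_pow_three (2 - θ) (1 + θ) (by linear_combination (-θ + 2) * hθ)
        ⟨1 - θ + θ ^ 2, by linear_combination -hθ⟩
        ⟨3 + θ - θ ^ 2, by linear_combination hθ⟩
        ⟨-5 + θ + θ ^ 2, by linear_combination -hθ⟩
        ⟨6 - 3 * θ, by linear_combination hθ⟩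
    · refine ⟨1 - θ + θ ^ 2, ?_⟩
      rw [eq_span_of_quadratic_mem hadj hlp hlQ
        (hlin (by decide) h) (key 1 (by norm_num) h)]
      push_cast
      exact span_pair_pow_three (-28 - 17 * θ - 10 * θ ^ 2) (1 - θ + θ ^ 2)
        (by linear_combination ((-32) + (-19)*θ + (-11)*θ^2 + (-4)*θ^3 + (-2)*θ^4 + (-1)*θ^5) * hθ)
        ⟨1 + θ, by linear_combination ((-1)) * hθ⟩
        ⟨4 + θ + θ ^ 2, by linear_combination ((-1)*θ) * hθ⟩
        ⟨9 + 6 * θ + 3 * θ ^ 2, by linear_combination ((1) + (-1)*θ) * hθ⟩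
        ⟨36 + 18 * θ + 9 * θ ^ 2, by linear_combination ((5) + (-3)*θ + (3)*θ^2 + (1)*θ^3) * hθ⟩
  · have h : θ - (1 : ℤ) ∈ Q := cube_mem (2 + θ - θ ^ 2) (by push_cast; linear_combination hθ)
    refine ⟨3, ?_⟩
    rw [eq_span_of_linear_mem hadj hlp hlQ h]
    push_cast
    exact span_pair_pow_three (6 - 3 * θ) (-2 + 4 * θ - 3 * θ ^ 2)
      (by linear_combination ((23) + (-13)*θ + (3)*θ^2) * hθ)
        ⟨9, by norm_num⟩
        ⟨-3 + 3 * θ, by ring⟩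
        ⟨1 - 2 * θ + θ ^ 2, by ring⟩
        ⟨2 + θ - θ ^ 2, by linear_combination hθ⟩
  · by_cases h : θ - (3 : ℤ) ∈ Q
    · refine ⟨5 + 4 * θ + 2 * θ ^ 2, ?_⟩
      rw [eq_span_of_linear_mem hadj hlp hlQ h]
      push_cast
      exact span_pair_pow_three (-11 + 6 * θ) (-6 + 4 * θ + 8 * θ ^ 2)
        (by linear_combination ((-174) + (68)*θ + (-8)*θ^2) * hθ)
        ⟨-31 + 8 * θ + 6 * θ ^ 2, by linear_combination ((-40) + (-12)*θ) * hθ⟩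
        ⟨27 - 11 * θ - 2 * θ ^ 2, by linear_combination ((30) + (4)*θ) * hθ⟩
        ⟨-19 + 12 * θ - θ ^ 2, by linear_combination ((-20) + (2)*θ) * hθ⟩
        ⟨10 - 11 * θ + 3 * θ ^ 2, by linear_combination ((11) + (-6)*θ) * hθ⟩
    · refine ⟨-31 + 8 * θ + 6 * θ ^ 2, ?_⟩
      rw [eq_span_of_quadratic_mem hadj hlp hlQ
        (hlin (by decide) h) (key 3 (by norm_num) h)]
      push_cast
      exact span_pair_pow_three (31 + 14 * θ + 8 * θ ^ 2) (θ - θ ^ 2)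
        (by linear_combination ((558) + (353)*θ + (142)*θ^2 + (45)*θ^3 + (8)*θ^4 + (1)*θ^5) * hθ)
        ⟨5 + 4 * θ + 2 * θ ^ 2, by linear_combination ((-40) + (-12)*θ) * hθ⟩
        ⟨23 + 13 * θ + 7 * θ ^ 2, by linear_combination ((-134) + (-42)*θ) * hθ⟩
        ⟨89 + 47 * θ + 25 * θ ^ 2, by linear_combination ((-452) + (-145)*θ) * hθ⟩
        ⟨331 + 173 * θ + 91 * θ ^ 2, by linear_combination ((-1570) + (-492)*θ + (9)*θ^2 + (1)*θ^3) * hθ⟩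
  · have h : θ - (0 : ℤ) ∈ Q := cube_mem 1 (by push_cast; linear_combination hθ)
    refine ⟨7, ?_⟩
    rw [eq_span_of_linear_mem hadj hlp hlQ h]
    push_cast
    exact span_pair_pow_three 0 1 (by linear_combination -hθ)
        ⟨49, by norm_num⟩
        ⟨7 * θ, by ring⟩
        ⟨θ ^ 2, by ring⟩
        ⟨1, by linear_combination hθ⟩
end

theorem isPrincipal_pow_three_of_prime {R : Type*} [CommRing R] [IsDedekindDomain R]
    (J : Ideal R) (hJ : J ≠ ⊥)
    (h : ∀ Q : Ideal R, Q.IsPrime → Q ∣ J → ∃ d, Q ^ 3 = Ideal.span {d}) :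
    ∃ d, J ^ 3 = Ideal.span {d} := by
  induction J using UniqueFactorizationMonoid.induction_on_prime with
  | h₁ => exact absurd rfl hJ
  | h₂ J hu => exact ⟨1, by rw [Ideal.isUnit_iff.1 hu, Ideal.span_singleton_one, ← Ideal.one_eq_top,
      one_pow]⟩
  | h₃ J Q hJ0 hQ ih =>
    obtain ⟨d, hd⟩ := h Q (Ideal.isPrime_of_prime hQ) (dvd_mul_right Q J)
    obtain ⟨e, he⟩ := ih hJ0 fun Q' hQ' hdvd => h Q' hQ' (hdvd.mul_left Q)
    exact ⟨d * e, by rw [mul_pow, hd, he, Ideal.span_singleton_mul_span_singleton]⟩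

section
variable {K : Type*} [Field K] [NumberField K] {θ : 𝓞 K}

theorem nrComplexPlaces_eq_one_of_pow_three_eq_seven (h3 : Module.finrank ℚ K = 3)
    (hθ : θ ^ 3 = 7) : InfinitePlace.nrComplexPlaces K = 1 := by
  have h := InfinitePlace.card_add_two_mul_card_eq_rank K
  have hs := NumberField.sign_discr K
  rw [discr_of_pow_three_eq_seven h3 hθ] at hs
  have : InfinitePlace.nrComplexPlaces K ≠ 0 := fun h0 => by
    rw [h0] at hs
    exact absurd hs (by decide)
  omega

theorem rank_eq_one_of_pow_three_eq_seven (h3 : Module.finrank ℚ K = 3) (hθ : θ ^ 3 = 7) :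
    Units.rank K = 1 := by
  have h := InfinitePlace.card_add_two_mul_card_eq_rank K
  have h1 := nrComplexPlaces_eq_one_of_pow_three_eq_seven h3 hθ
  have := InfinitePlace.card_eq_nrRealPlaces_add_nrComplexPlaces K
  rw [Units.rank]
  omega

theorem pow_three_eq_span_of_absNorm_le (h3 : Module.finrank ℚ K = 3) (hθ : θ ^ 3 = 7)
    {J : Ideal (𝓞 K)} (hJ : J ≠ ⊥) (hn : Ideal.absNorm J ≤ 10) :
    ∃ d, J ^ 3 = Ideal.span {d} := by
  refine isPrincipal_pow_three_of_prime J hJ fun Q hQ hQJ => ?_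
  have hadj := adjoin_eq_top_of_pow_three_eq_seven h3 hθ
  have hmem : (Ideal.absNorm J : 𝓞 K) ∈ Q := Ideal.le_of_dvd hQJ (Ideal.absNorm_mem J)
  have h0 : Ideal.absNorm J ≠ 0 := fun h => hJ (Ideal.absNorm_eq_zero_iff.1 h)
  obtain ⟨l, hl, hlQ⟩ : ∃ l : ℕ, (l = 2 ∨ l = 3 ∨ l = 5 ∨ l = 7) ∧ (l : 𝓞 K) ∈ Q := by
    generalize Ideal.absNorm J = n at hmem hn h0
    have hn1 : n ≠ 1 := by
      rintro rfl
      exact hQ.ne_top ((Ideal.eq_top_iff_one _).2 (by simpa using hmem))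
    rw [← Nat.prod_primeFactorsList h0, Nat.cast_list_prod, ← Multiset.prod_coe,
      hQ.multiset_prod_mem_iff_exists_mem] at hmem
    obtain ⟨p, hp, hpQ⟩ := hmem
    obtain ⟨l, hl, rfl⟩ := List.mem_map.1 (Multiset.mem_coe.1 hp)
    have hlp := Nat.prime_of_mem_primeFactorsList hl
    have hle := (Nat.le_of_mem_primeFactorsList hl).trans hn
    refine ⟨l, ?_, hpQ⟩
    clear hp hl hpQ
    interval_cases l <;> first | omega | exact absurd hlp (by norm_num)
  exact exists_prime_pow_three_eq_span hadj hθ hl hlQ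

theorem ideal_pow_three_eq_span (h3 : Module.finrank ℚ K = 3) (hθ : θ ^ 3 = 7)
    {I : Ideal (𝓞 K)} (hI : I ≠ ⊥) : ∃ d, I ^ 3 = Ideal.span {d} := by
  obtain ⟨J, hJI, hJ⟩ := exists_ideal_in_class_of_norm_le
    (ClassGroup.mk0 ⟨I, mem_nonZeroDivisors_iff_ne_zero.2 hI⟩)
  have hJ10 : Ideal.absNorm (J : Ideal (𝓞 K)) ≤ 10 := by
    rw [nrComplexPlaces_eq_one_of_pow_three_eq_seven h3 hθ, discr_of_pow_three_eq_seven h3 hθ,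
      h3] at hJ
    have hs : √|((-1323 : ℤ) : ℝ)| ≤ 36.4 := by
      rw [Real.sqrt_le_left (by norm_num)]
      norm_num
    have hpi : 4 / Real.pi ≤ 1.2742 := by
      rw [div_le_iff₀ Real.pi_pos]
      linarith [Real.pi_gt_d2]
    have hp0 : 0 ≤ 4 / Real.pi := by positivity
    have : (Ideal.absNorm (J : Ideal (𝓞 K)) : ℝ) < 11 := by
      refine hJ.trans_lt ?_
      norm_num [Nat.factorial] at hs ⊢
      nlinarith
    exact Nat.lt_succ_iff.1 (by exact_mod_cast this)
  obtain ⟨d, hd⟩ := pow_three_eq_span_of_absNorm_le h3 hθ (nonZeroDivisors.coe_ne_zero J) hJ10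
  have h1 : ClassGroup.mk0 (J ^ 3) = 1 := by
    rw [ClassGroup.mk0_eq_one_iff, SubmonoidClass.coe_pow, hd]
    exact ⟨d, rfl⟩
  rw [map_pow, hJI, ← map_pow, ClassGroup.mk0_eq_one_iff] at h1
  obtain ⟨e, he⟩ := h1
  exact ⟨e, he⟩

/-- In a number field of odd degree and unit rank one, two characters of order `7` of the unit group
are proportional. -/
theorem units_map_eq_one_of_rank_eq_one (hodd : Odd (Module.finrank ℚ K)) (hr : Units.rank K = 1)
    (f g : (𝓞 K)ˣ →* Multiplicative (ZMod 7)) {u : (𝓞 K)ˣ} (hf : f u ≠ 1) (hg : g u = 1)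
    (ε : (𝓞 K)ˣ) : g ε = 1 := by
  have : Unique (Fin (Units.rank K)) := by rw [hr]; infer_instance
  have htors : ∀ (f : (𝓞 K)ˣ →* Multiplicative (ZMod 7)) (ζ : Units.torsion K),
      f (ζ : (𝓞 K)ˣ) = 1 := by
    intro f ζ
    have h2 : f (ζ : (𝓞 K)ˣ) ^ 2 = 1 := by
      rw [← map_pow]
      rcases Units.torsion_eq_one_or_neg_one_of_odd_finrank hodd ζ with h | h <;> simp [h]
    have : ∀ a : Multiplicative (ZMod 7), a ^ 2 = 1 → a = 1 := by decide
    exact this _ h2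
  obtain ⟨η, hη⟩ : ∃ η : (𝓞 K)ˣ, ∀ x : (𝓞 K)ˣ, ∃ n : ℤ,
      ∀ f : (𝓞 K)ˣ →* Multiplicative (ZMod 7), f x = f η ^ n := by
    refine ⟨Units.fundSystem K default, fun x => ?_⟩
    obtain ⟨⟨ζ, e⟩, hx, -⟩ := Units.exist_unique_eq_mul_prod K x
    refine ⟨e default, fun f => ?_⟩
    rw [hx, map_mul, htors, one_mul, Fintype.prod_unique, map_zpow]
  obtain ⟨n, hn⟩ := hη u
  obtain ⟨m, hm⟩ := hη ε
  have hgη : g η = 1 := by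
    rw [hn] at hf hg
    have h7 : ∀ a : Multiplicative (ZMod 7), a ^ 7 = 1 := by decide
    have hn7 : ¬ (7 : ℤ) ∣ n := by
      rintro ⟨k, rfl⟩
      exact hf (by rw [zpow_mul]; norm_cast; rw [h7, one_zpow])
    obtain ⟨a, b, hab⟩ := (Int.prime_iff_natAbs_prime.2 (by norm_num : (7 : ℤ).natAbs.Prime)
      ).coprime_iff_not_dvd.2 hn7
    rw [← zpow_one (g η), ← hab, zpow_add, mul_comm a, mul_comm b, zpow_mul, zpow_mul, hg, one_zpow,
      mul_one]
    norm_cast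
    rw [h7, one_zpow]
  rw [hm, hgη, one_zpow]
end

instance Nat.fact_prime_seven : Fact (Nat.Prime 7) := ⟨by norm_num⟩

section
variable {K : Type*} [Field K] [NumberField K] {θ : 𝓞 K}

theorem exists_ringHom_matrix_of_pow_three_eq_seven (h3 : Module.finrank ℚ K = 3)
    (hθ : θ ^ 3 = 7) :
    ∃ F : 𝓞 K →+* Matrix (Fin 3) (Fin 3) (ZMod 7), F θ = !![0, 1, 0; 0, 0, 1; 0, 0, 0] := by
  obtain ⟨B, hB⟩ := exists_powerBasis_int_of_pow_three_eq_seven h3 hθ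
  have ht : (θ : K) ^ 3 = 7 := by
    have := congrArg (algebraMap (𝓞 K) K) hθ
    rwa [map_pow, map_ofNat] at this
  have hm : minpoly ℤ B.gen = X ^ 3 - C 7 := by
    rw [hB, ← minpoly.algebraMap_eq (B := 𝓞 K) (B' := K) RingOfIntegers.coe_injective]
    exact minpoly_int_of_pow_three_eq_seven ht
  have hM : aeval (!![0, 1, 0; 0, 0, 1; 0, 0, 0] : Matrix (Fin 3) (Fin 3) (ZMod 7))
      (minpoly ℤ B.gen) = 0 := by
    rw [hm]
    simp only [map_sub, map_pow, aeval_X, aeval_C]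
    simp only [eq_intCast]
    decide
  refine ⟨(B.lift _ hM).toRingHom, ?_⟩
  have := B.lift_gen _ hM
  rwa [hB] at this

/-- The residue, and two logarithmic coordinates, of an element of the ring of integers of `ℚ(∛7)`
modulo `7 = θ³`; the second logarithmic coordinate is normalised to vanish on the unit `2 - θ`. -/
theorem exists_log_coordinates (h3 : Module.finrank ℚ K = 3) (hθ : θ ^ 3 = 7) :
    ∃ (ρ : 𝓞 K →+* ZMod 7) (f g : 𝓞 K → ZMod 7),
      (∀ x y, ρ x ≠ 0 → ρ y ≠ 0 → f (x * y) = f x + f y) ∧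
      (∀ x y, ρ x ≠ 0 → ρ y ≠ 0 → g (x * y) = g x + g y) ∧
      ∀ a b c : ℤ, ρ (a + b * θ + c * θ ^ 2) = a ∧
        f (a + b * θ + c * θ ^ 2) = (b : ZMod 7) / (a : ZMod 7) ∧
        g (a + b * θ + c * θ ^ 2) =
          (c : ZMod 7) / (a : ZMod 7) + 3 * ((b : ZMod 7) / (a : ZMod 7)) ^ 2 -
            2 * ((b : ZMod 7) / (a : ZMod 7)) := by
  obtain ⟨F, hF⟩ := exists_ringHom_matrix_of_pow_three_eq_seven h3 hθ
  have hT : ∀ x, F x 1 0 = 0 ∧ F x 2 0 = 0 ∧ F x 2 1 = 0 ∧ F x 1 1 = F x 0 0 ∧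
      F x 2 2 = F x 0 0 ∧ F x 1 2 = F x 0 1 := by
    intro x
    have h : F x * F θ = F θ * F x := by rw [← map_mul, ← map_mul, mul_comm]
    rw [hF] at h
    have h00 := congrFun (congrFun h 0) 0
    have h10 := congrFun (congrFun h 1) 0
    have h01 := congrFun (congrFun h 0) 1
    have h02 := congrFun (congrFun h 0) 2
    have h11 := congrFun (congrFun h 1) 1
    have h12 := congrFun (congrFun h 1) 2
    simp [Matrix.mul_apply, Fin.sum_univ_three] at h00 h10 h01 h02 h11 h12
    grind
  have hmul : ∀ x y, F (x * y) 0 0 = F x 0 0 * F y 0 0 ∧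
      F (x * y) 0 1 = F x 0 0 * F y 0 1 + F x 0 1 * F y 0 0 ∧
      F (x * y) 0 2 = F x 0 0 * F y 0 2 + F x 0 1 * F y 0 1 + F x 0 2 * F y 0 0 := by
    intro x y
    obtain ⟨h10, h20, h21, h11, h22, h12⟩ := hT y
    simp only [map_mul, Matrix.mul_apply, Fin.sum_univ_three, h10, h20, h21, h11, h22, h12]
    refine ⟨?_, ?_, ?_⟩ <;> simp only [mul_zero, add_zero]
  have hcoord : ∀ a b c : ℤ, F (a + b * θ + c * θ ^ 2) =
      !![(a : ZMod 7), b, c; 0, a, b; 0, 0, a] := by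
    intro a b c
    simp only [pow_two, map_add, map_mul, map_intCast, hF]
    ext i j
    fin_cases i <;> fin_cases j <;>
      simp [Matrix.add_apply, Matrix.mul_apply, Matrix.intCast_apply]
  have h7 : (7 : ZMod 7) = 0 := rfl
  refine ⟨⟨⟨⟨fun x => F x 0 0, by simp⟩, fun x y => (hmul x y).1⟩, by simp,
    fun x y => by simp⟩, fun x => F x 0 1 / F x 0 0,
    fun x => F x 0 2 / F x 0 0 + 3 * (F x 0 1 / F x 0 0) ^ 2 - 2 * (F x 0 1 / F x 0 0),
    fun x y hx hy => ?_, fun x y hx hy => ?_, fun a b c => ⟨?_, ?_, ?_⟩⟩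
  · obtain ⟨e0, e1, -⟩ := hmul x y
    change F x 0 0 ≠ 0 at hx
    change F y 0 0 ≠ 0 at hy
    simp only [e0, e1]
    field_simp
    ring
  · obtain ⟨e0, e1, e2⟩ := hmul x y
    change F x 0 0 ≠ 0 at hx
    change F y 0 0 ≠ 0 at hy
    simp only [e0, e1, e2]
    field_simp
    linear_combination (F x 0 0 * F x 0 1 * F y 0 0 * F y 0 1) * h7
  · change F _ 0 0 = _
    simp [hcoord]
  · simp [hcoord]
  · simp [hcoord]

theorem log_coordinate_unit_eq_zero (h3 : Module.finrank ℚ K = 3) (hθ : θ ^ 3 = 7)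
    {ρ : 𝓞 K →+* ZMod 7} {f g : 𝓞 K → ZMod 7}
    (hf : ∀ x y, ρ x ≠ 0 → ρ y ≠ 0 → f (x * y) = f x + f y)
    (hg : ∀ x y, ρ x ≠ 0 → ρ y ≠ 0 → g (x * y) = g x + g y)
    (hfu : f (2 - θ) ≠ 0) (hgu : g (2 - θ) = 0) (ε : (𝓞 K)ˣ) : g ε = 0 := by
  have hρ : ∀ ε : (𝓞 K)ˣ, ρ ε ≠ 0 := fun ε => (ε.isUnit.map ρ).ne_zero
  let lift (f : 𝓞 K → ZMod 7) (hf : ∀ x y, ρ x ≠ 0 → ρ y ≠ 0 → f (x * y) = f x + f y) :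
      (𝓞 K)ˣ →* Multiplicative (ZMod 7) :=
    MonoidHom.mk' (fun ε => Multiplicative.ofAdd (f ε)) fun x y => by
      rw [Units.val_mul, hf _ _ (hρ x) (hρ y), ofAdd_add]
  let u : (𝓞 K)ˣ := ⟨2 - θ, 4 + 2 * θ + θ ^ 2, by linear_combination -hθ, by linear_combination -hθ⟩
  exact units_map_eq_one_of_rank_eq_one (by rw [h3]; decide)
    (rank_eq_one_of_pow_three_eq_seven h3 hθ) (lift f hf) (lift g hg) (u := u) hfu hgu ε

/-- An element whose ideal is a seventh power has trivial second logarithmic coordinate. -/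
theorem log_coordinate_eq_zero_of_span_eq_pow (h3 : Module.finrank ℚ K = 3) (hθ : θ ^ 3 = 7)
    {ρ : 𝓞 K →+* ZMod 7} {f g : 𝓞 K → ZMod 7}
    (hf : ∀ x y, ρ x ≠ 0 → ρ y ≠ 0 → f (x * y) = f x + f y)
    (hg : ∀ x y, ρ x ≠ 0 → ρ y ≠ 0 → g (x * y) = g x + g y)
    (hfu : f (2 - θ) ≠ 0) (hgu : g (2 - θ) = 0) {β : 𝓞 K} (hβ : ρ β ≠ 0) {I : Ideal (𝓞 K)}
    (hI : I ^ 7 = Ideal.span {β}) : g β = 0 := by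
  have hI0 : I ≠ ⊥ := by
    rintro rfl
    rw [Ideal.bot_pow (by norm_num), eq_comm, Ideal.span_singleton_eq_bot] at hI
    exact hβ (by rw [hI, map_zero])
  obtain ⟨δ, hδ⟩ := ideal_pow_three_eq_span h3 hθ hI0
  have hassoc : Associated (β ^ 3) (δ ^ 7) := by
    rw [← Ideal.span_singleton_eq_span_singleton, ← Ideal.span_singleton_pow,
      ← Ideal.span_singleton_pow, ← hI, ← hδ, ← pow_mul, ← pow_mul]
  obtain ⟨ε, hε⟩ := hassoc
  have hρε : ρ ε ≠ 0 := (ε.isUnit.map ρ).ne_zero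
  have hgpow : ∀ x, ρ x ≠ 0 → ∀ n : ℕ, g (x ^ (n + 1)) = (n + 1) * g x := by
    intro x hx n
    induction n with
    | zero => simp
    | succ n ih =>
      rw [pow_succ, hg _ _ (by rw [map_pow]; exact pow_ne_zero _ hx) hx, ih]
      push_cast; ring
  have hρβ : ρ (β ^ 3) ≠ 0 := by rw [map_pow]; exact pow_ne_zero _ hβ
  have hδ0 : ρ δ ≠ 0 := by
    intro h0
    have := congrArg ρ hε
    rw [map_mul, map_pow ρ δ, h0, zero_pow (by norm_num)] at this
    exact mul_ne_zero hρβ hρε this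
  have h := congrArg g hε
  rw [hg _ _ hρβ hρε, log_coordinate_unit_eq_zero h3 hθ hf hg hfu hgu, hgpow β hβ 2,
    hgpow δ hδ0 6] at h
  have h7 : (7 : ZMod 7) = 0 := rfl
  push_cast at h
  linear_combination 5 * h + (5 * g δ - 2 * g β) * h7

end

theorem isCoprime_of_pow_three_eq_mul {x y z : ℤ} {p : ℕ} (hp : p.Prime) {n : ℕ}
    (hgcd : Int.gcd x (Int.gcd y z) = 1) (h : x ^ 3 + 7 * y ^ 3 = (p : ℤ) ^ n * z ^ 7)
    (hxy : ¬((p : ℤ) ∣ x ∧ (p : ℤ) ∣ y)) : IsCoprime x y := by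
  rw [Int.isCoprime_iff_gcd_eq_one]
  by_contra hne
  obtain ⟨q, hq, hqd⟩ := Nat.exists_prime_and_dvd hne
  have hqx : (q : ℤ) ∣ x := (Int.natCast_dvd_natCast.2 hqd).trans (Int.gcd_dvd_left ..)
  have hqy : (q : ℤ) ∣ y := (Int.natCast_dvd_natCast.2 hqd).trans (Int.gcd_dvd_right ..)
  have hq' : Prime (q : ℤ) := Nat.prime_iff_prime_int.1 hq
  have hdvd : (q : ℤ) ∣ (p : ℤ) ^ n * z ^ 7 := by
    rw [← h]
    exact dvd_add (dvd_pow hqx (by norm_num)) (Dvd.dvd.mul_left (dvd_pow hqy (by norm_num)) _)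
  rcases hq'.dvd_or_dvd hdvd with h1 | h1
  · have := (Nat.prime_dvd_prime_iff_eq hq hp).1
      (Int.natCast_dvd_natCast.1 (hq'.dvd_of_dvd_pow h1))
    subst this
    exact hxy ⟨hqx, hqy⟩
  · have := Int.dvd_coe_gcd hqx (Int.dvd_coe_gcd hqy (hq'.dvd_of_dvd_pow h1))
    rw [hgcd] at this
    exact hq'.not_isUnit (isUnit_of_dvd_one (by simpa using this))

theorem not_seven_dvd_of_pow_three_eq_mul {x y z k : ℤ} (hxy : IsCoprime x y)
    (hk : ¬(7 : ℤ) ∣ k) (h : x ^ 3 + 7 * y ^ 3 = k * z ^ 7) : ¬(7 : ℤ) ∣ x := by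
  intro hx
  have h7 : Prime (7 : ℤ) := by norm_num
  have hz : (7 : ℤ) ∣ z := by
    refine h7.dvd_of_dvd_pow (n := 7) ((h7.dvd_or_dvd ?_).resolve_left hk)
    rw [← h]
    exact dvd_add (dvd_pow hx (by norm_num)) (dvd_mul_right _ _)
  have hy : (7 : ℤ) ∣ y := by
    obtain ⟨a, rfl⟩ := hx
    obtain ⟨b, rfl⟩ := hz
    exact h7.dvd_of_dvd_pow (n := 3) ⟨k * 7 ^ 5 * b ^ 7 - 7 * a ^ 3, by
      linarith⟩
  exact h7.not_isUnit (hxy.isUnit_of_dvd' hx hy)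

theorem not_three_dvd_of_pow_three_eq_mul {x y z k : ℤ} (hxy : IsCoprime x y)
    (hk : ¬(3 : ℤ) ∣ k) (h : x ^ 3 + 7 * y ^ 3 = k * z ^ 7) : ¬(3 : ℤ) ∣ x ^ 3 + 7 * y ^ 3 := by
  intro hd
  have hp : Prime (3 : ℤ) := by norm_num
  have h9 : ((x ^ 3 + 7 * y ^ 3 : ℤ) : ZMod 9) = 0 := by
    rw [h] at hd ⊢
    obtain ⟨b, rfl⟩ := hp.dvd_of_dvd_pow ((hp.dvd_or_dvd hd).resolve_left hk)
    exact (ZMod.intCast_zmod_eq_zero_iff_dvd _ 9).2 ⟨k * 243 * b ^ 7, by push_cast; ring⟩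
  have key : ∀ a b : ZMod 9, a ^ 3 + 7 * b ^ 3 = 0 → 3 * a = 0 ∧ 3 * b = 0 := by decide
  push_cast at h9
  obtain ⟨hx, hy⟩ := key _ _ h9
  have hdvd : ∀ {t : ℤ}, (3 : ZMod 9) * (t : ZMod 9) = 0 → (3 : ℤ) ∣ t := fun {t} ht => by
    have := (ZMod.intCast_zmod_eq_zero_iff_dvd (3 * t) 9).1 (by exact_mod_cast ht)
    omega
  exact hp.not_isUnit (hxy.isUnit_of_dvd' (hdvd hx) (hdvd hy))

theorem prime_262193 : Nat.Prime 262193 := by norm_num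

theorem dvd_sub_of_dvd_pow_three_add {x y : ℤ} (h : (262193 : ℤ) ∣ x ^ 3 + 7 * y ^ 3) :
    (262193 : ℤ) ∣ 64 * x - 7 * y := by
  have : Fact (Nat.Prime 262193) := ⟨prime_262193⟩
  have hcube : ∀ a : ZMod 262193, a = (a ^ 3) ^ 174795 := fun a => by
    calc a = a ^ 262193 := (ZMod.pow_card a).symm
      _ = a * a ^ 262192 := by rw [← pow_succ']
      _ = a ^ 262193 * a ^ 262192 := by rw [ZMod.pow_card a]
      _ = (a ^ 3) ^ 174795 := by rw [← pow_add, ← pow_mul]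
  have h0 := (ZMod.intCast_zmod_eq_zero_iff_dvd _ 262193).2 h
  have hp : (262193 : ZMod 262193) = 0 := ZMod.natCast_self 262193
  push_cast at h0
  refine (ZMod.intCast_zmod_eq_zero_iff_dvd _ 262193).1 ?_
  push_cast
  have : (64 * x : ZMod 262193) ^ 3 = (7 * y) ^ 3 := by
    linear_combination 64 ^ 3 * h0 - 7 * (y : ZMod 262193) ^ 3 * hp
  rw [hcube (64 * x), this, ← hcube, sub_self]

section
variable {R : Type*} [CommRing R]

theorem isCoprime_linear_quadratic {θ : R} (hθ : θ ^ 3 = 7) {x y : ℤ} (hxy : IsCoprime x y)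
    (h7 : IsCoprime x 7) (h3 : IsCoprime (x ^ 3 + 7 * y ^ 3) 3) :
    IsCoprime (x + y * θ) (x ^ 2 - x * y * θ + y ^ 2 * θ ^ 2) := by
  have hxy' : IsCoprime (x : R) y := hxy.map (Int.castRingHom R)
  have h7' : IsCoprime (x : R) 7 := by simpa using h7.map (Int.castRingHom R)
  have h3' : IsCoprime (x ^ 3 + 7 * y ^ 3 : R) 3 := by simpa using h3.map (Int.castRingHom R)
  have hx : IsCoprime (x + y * θ) (x : R) := by
    have : IsCoprime (x : R) (y * θ) :=
      hxy'.mul_right ((IsCoprime.pow_right_iff (m := 3) (by norm_num)).1 (hθ ▸ h7'))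
    simpa [add_comm] using this.symm.add_mul_right_left 1
  have h3X : IsCoprime (x + y * θ) (3 : R) := by
    refine IsCoprime.of_mul_left_left (y := x ^ 2 - x * y * θ + y ^ 2 * θ ^ 2) ?_
    convert h3' using 1
    linear_combination (y : R) ^ 3 * hθ
  have := (h3X.mul_right (hx.pow_right (n := 2))).add_mul_left_right (y * θ - 2 * x)
  convert this using 1
  ring

theorem exists_eq_pow_mul_of_isCoprime [IsDomain R] {a b s t w : R} {n : ℕ} (hab : IsCoprime a b)
    (hs : s ∣ a) (ht : t ∣ b) (hs0 : s ≠ 0) (ht0 : t ≠ 0) (h : a * b = (s * t) ^ n * w) :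
    ∃ β γ, a = s ^ n * β ∧ IsCoprime β γ ∧ β * γ = w := by
  have h1 : s ^ n ∣ a := ((hab.of_isCoprime_of_dvd_left hs).pow_left).dvd_of_dvd_mul_right
    (h ▸ (Dvd.intro _ (mul_pow s t n).symm).mul_right w)
  have h2 : t ^ n ∣ b := ((hab.symm.of_isCoprime_of_dvd_left ht).pow_left).dvd_of_dvd_mul_left
    (h ▸ (Dvd.intro_left _ (mul_pow s t n).symm).mul_right w)
  obtain ⟨β, rfl⟩ := h1
  obtain ⟨γ, rfl⟩ := h2
  refine ⟨β, γ, rfl, hab.of_mul_left_right.of_mul_right_right, ?_⟩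
  refine mul_left_cancel₀ (pow_ne_zero n (mul_ne_zero hs0 ht0)) ?_
  rw [← h]
  ring

end

section
variable {K : Type*} [Field K] [NumberField K] {θ : 𝓞 K}

theorem dvd_of_pow_three_add_eq (h3 : Module.finrank ℚ K = 3) (hθ : θ ^ 3 = 7) {x y z : ℤ}
    (hgcd : Int.gcd x (Int.gcd y z) = 1) (h : x ^ 3 + 7 * y ^ 3 = 262193 ^ 4 * z ^ 7) :
    (262193 : ℤ) ∣ x ∧ (262193 : ℤ) ∣ y := by
  by_contra hn
  have hxy : IsCoprime x y :=
    isCoprime_of_pow_three_eq_mul prime_262193 hgcd (by exact_mod_cast h) (by exact_mod_cast hn)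
  have hx7 := not_seven_dvd_of_pow_three_eq_mul hxy (by norm_num) h
  have hx3 := not_three_dvd_of_pow_three_eq_mul hxy (by norm_num) h
  have hcop := isCoprime_linear_quadratic hθ hxy
    ((Prime.coprime_iff_not_dvd (by norm_num)).2 hx7).symm
    ((Prime.coprime_iff_not_dvd (by norm_num)).2 hx3).symm
  have hpp : (64 + θ ^ 2) * (4096 + 7 * θ - 64 * θ ^ 2) = 262193 := by
    linear_combination (7 - 64 * θ) * hθ
  have hp0 : (64 + θ ^ 2) * (4096 + 7 * θ - 64 * θ ^ 2) ≠ 0 := by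
    rw [hpp]; norm_num
  have hXC : (x + y * θ) * (x ^ 2 - x * y * θ + y ^ 2 * θ ^ 2) =
      ((64 + θ ^ 2) * (4096 + 7 * θ - 64 * θ ^ 2)) ^ 4 * (z : 𝓞 K) ^ 7 := by
    have h' : (x : 𝓞 K) ^ 3 + 7 * y ^ 3 = 262193 ^ 4 * z ^ 7 := by exact_mod_cast h
    rw [hpp, ← h']
    linear_combination (y : 𝓞 K) ^ 3 * hθ
  obtain ⟨m, hm⟩ := dvd_sub_of_dvd_pow_three_add (h ▸ (dvd_pow_self _ (by norm_num)).mul_right _)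
  obtain ⟨n, hn⟩ : (262193 : ℤ) ∣ 7 * x + 4096 * y := by omega
  have hx : (x : 𝓞 K) = 4096 * m + 7 * n := by
    exact_mod_cast congrArg (Int.cast (R := 𝓞 K)) (show x = 4096 * m + 7 * n by omega)
  have hy : (y : 𝓞 K) = 64 * n - 7 * m := by
    exact_mod_cast congrArg (Int.cast (R := 𝓞 K)) (show y = 64 * n - 7 * m by omega)
  obtain ⟨β, γ, hβ, hβγ, hβγz⟩ := exists_eq_pow_mul_of_isCoprime hcop
    (s := 64 + θ ^ 2) (t := 4096 + 7 * θ - 64 * θ ^ 2)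
    ⟨64 * m + n * θ - m * θ ^ 2, by
      rw [hx, hy]; linear_combination (m * θ - n) * hθ⟩
    ⟨x * m - y * m * θ + (64 * m ^ 2 + n ^ 2) * θ ^ 2, by
      rw [hx, hy]
      linear_combination (-(7 * (64 * m ^ 2 + n ^ 2) + 64 * (64 * n - 7 * m) * m
        - 64 * (64 * m ^ 2 + n ^ 2) * θ) : 𝓞 K) * hθ⟩
    (left_ne_zero_of_mul hp0) (right_ne_zero_of_mul hp0) hXC
  obtain ⟨ρ, f, g, hf, hg, hcoord⟩ := exists_log_coordinates h3 hθ
  have hX := hcoord x y 0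
  have hu := hcoord 2 (-1) 0
  have hπ := hcoord 64 0 1
  push_cast at hX hu hπ
  rw [show (x : 𝓞 K) + y * θ + 0 * θ ^ 2 = (64 + θ ^ 2) ^ 4 * β by rw [← hβ]; ring] at hX
  rw [show (2 : 𝓞 K) + -1 * θ + 0 * θ ^ 2 = 2 - θ by ring] at hu
  rw [show (64 : 𝓞 K) + 0 * θ + 1 * θ ^ 2 = 64 + θ ^ 2 by ring] at hπ
  have hx0 : (x : ZMod 7) ≠ 0 := fun h0 => hx7 ((ZMod.intCast_zmod_eq_zero_iff_dvd _ 7).1 h0)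
  have hρ : ρ ((64 + θ ^ 2) ^ 4 * β) ≠ 0 := hX.1 ▸ hx0
  rw [map_mul] at hρ
  have hρβ := right_ne_zero_of_mul hρ
  have hρπ : ρ (64 + θ ^ 2) ≠ 0 := by rw [hπ.1]; decide
  have hρπ2 : ρ ((64 + θ ^ 2) ^ 2) ≠ 0 := by rw [map_pow]; exact pow_ne_zero _ hρπ
  have h2 : (2 : ZMod 7)⁻¹ = 4 := inv_eq_of_mul_eq_one_right (by decide)
  have h64 : (64 : ZMod 7) = 1 := rfl
  have hgβ : g β = 0 := log_coordinate_eq_zero_of_span_eq_pow h3 hθ hf hg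
    (by rw [hu.2.1, div_eq_mul_inv, h2]; decide)
    (by rw [hu.2.2, div_eq_mul_inv, div_eq_mul_inv, h2]; decide) hρβ (span_pair_pow_seven hβγz hβγ)
  have hgX := hX.2.2
  rw [hg _ _ (left_ne_zero_of_mul hρ) hρβ, hgβ,
    show (64 + θ ^ 2) ^ 4 = (64 + θ ^ 2) ^ 2 * (64 + θ ^ 2) ^ 2 by ring, hg _ _ hρπ2 hρπ2,
    pow_two (64 + θ ^ 2), hg _ _ hρπ hρπ, hπ.2.2] at hgX
  generalize (y : ZMod 7) / (x : ZMod 7) = t at hgX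
  simp only [zero_div, h64, div_one] at hgX
  revert t
  decide

end

/-- Every primitive integer solution of `x³ + 7y³ = 262193⁴ z⁷` satisfies
`x ≡ y ≡ 0 (mod 262193)`. -/
theorem fermat_descent_deg7 :
    ∀ x y z : ℤ, Int.gcd x (Int.gcd y z) = 1 →
      x ^ 3 + 7 * y ^ 3 = 262193 ^ 4 * z ^ 7 →
      (262193 : ℤ) ∣ x ∧ (262193 : ℤ) ∣ y := by
  intro x y z hgcd h
  have hmonic : (X ^ 3 - C 7 : ℤ[X]).Monic := by monicity!
  have hdeg : (X ^ 3 - C 7 : ℤ[X]).natDegree = 3 := by compute_degree!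
  have hmap : (X ^ 3 - C 7 : ℤ[X]).map (algebraMap ℤ ℚ) = X ^ 3 - C 7 := by
    simp only [Polynomial.map_sub, Polynomial.map_pow, map_X, map_C]
    rfl
  have hirr : Irreducible (X ^ 3 - C 7 : ℚ[X]) := by
    rw [← hmap, ← hmonic.irreducible_iff_irreducible_map_fraction_map]
    exact isEisensteinAt_X_pow_three_sub_seven.irreducible
      ((Ideal.span_singleton_prime (by norm_num)).2 (by norm_num)) hmonic.isPrimitive
      (by rw [hdeg]; norm_num)
  have : Fact (Irreducible (X ^ 3 - C 7 : ℚ[X])) := ⟨hirr⟩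
  let B := AdjoinRoot.powerBasis hirr.ne_zero
  have : FiniteDimensional ℚ (AdjoinRoot (X ^ 3 - C 7 : ℚ[X])) := B.finite
  have : NumberField (AdjoinRoot (X ^ 3 - C 7 : ℚ[X])) := { }
  have ht : AdjoinRoot.root (X ^ 3 - C 7 : ℚ[X]) ^ 3 = 7 := by
    have := AdjoinRoot.eval₂_root (X ^ 3 - C 7 : ℚ[X])
    rw [eval₂_sub, eval₂_X_pow, eval₂_C, sub_eq_zero] at this
    exact this.trans (map_ofNat _ 7)
  refine dvd_of_pow_three_add_eq
    (θ := (⟨AdjoinRoot.root _, isIntegral_of_pow_three_eq_seven ht⟩ :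
      𝓞 (AdjoinRoot (X ^ 3 - C 7 : ℚ[X])))) ?_ ?_ hgcd h
  · rw [B.finrank, AdjoinRoot.powerBasis_dim, ← hmap, hmonic.natDegree_map, hdeg]
  · exact RingOfIntegers.ext ht
end

section
/- Every primitive triple of integers (x, y, z) satisfying x³ + 11y³ = 1000121⁶ · z¹¹ satisfies x ≡ y ≡ 0 (mod 1000121). -/
section

open Polynomial NumberField nonZeroDivisors

theorem discr_eq_of_pow_basis {R S : Type*} [CommRing R] [CommRing S] [Algebra R S]
    {θ : S} (hθ : θ ^ 3 = 11) (b : Module.Basis (Fin 3) R S) (hb : ∀ i, b i = θ ^ (i : ℕ)) :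
    Algebra.discr R b = -3267 := by
  have hL : Algebra.leftMulMatrix b θ = !![0, 0, 11; 1, 0, 0; 0, 1, 0] := by
    ext i j
    rw [Algebra.leftMulMatrix_eq_repr_mul, hb, ← pow_succ']
    fin_cases j
    · have : θ ^ 1 = b 1 := by simp [hb]
      simp only [Fin.zero_eta, zero_add, this]
      fin_cases i <;> simp
    · have : θ ^ 2 = b 2 := by simp [hb]
      simp only [Fin.mk_one, one_add_one_eq_two, this]
      fin_cases i <;> simp
    · have : θ ^ 3 = (11 : R) • b 0 := by
        simp only [hb, hθ, Algebra.smul_def, map_ofNat, Fin.val_zero, pow_zero, mul_one]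
      simp only [Fin.reduceFinMk, Nat.reduceAdd, this]
      fin_cases i <;> simp
  have t (k : ℕ) : Algebra.trace R S (θ ^ k)
      = Matrix.trace ((!![0, 0, 11; 1, 0, 0; 0, 1, 0] : Matrix (Fin 3) (Fin 3) R) ^ k) := by
    rw [Algebra.trace_eq_matrix_trace b, map_pow, hL]
  have : Algebra.traceMatrix R b = !![3, 0, 0; 0, 0, 33; 0, 33, 0] := by
    ext i j
    rw [Algebra.traceMatrix_apply, Algebra.traceForm_apply, hb, hb, ← pow_add, t]
    fin_cases i <;> fin_cases j <;>
      simp [Matrix.trace_fin_three, pow_succ] <;> norm_num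
  rw [Algebra.discr_def, this, Matrix.det_fin_three]
  simp
  norm_num

/-- The polynomial `X ^ 3 - 11`. -/
noncomputable abbrev cubicPoly : ℚ[X] := X ^ 3 - C 11

instance fact_irreducible_cubicPoly : Fact (Irreducible cubicPoly) := by
  refine ⟨X_pow_sub_C_irreducible_of_prime Nat.prime_three fun q hq ↦ ?_⟩
  have : IsIntegral ℤ q := ⟨X ^ 3 - C 11, monic_X_pow_sub_C _ (by norm_num), by simp [hq]⟩
  obtain ⟨n, rfl⟩ := IsIntegrallyClosed.isIntegral_iff.mp this
  have h : n ^ 3 = 11 := by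
    rw [eq_intCast] at hq
    exact_mod_cast hq
  have h1 : 2 < n := by by_contra! hn; nlinarith [sq_nonneg n, sq_nonneg (n+2)]
  nlinarith [mul_pos (sub_pos.2 h1) (sub_pos.2 h1)]

theorem isEisensteinAt_minpoly_of_cubic {S : Type*} [CommRing S] [IsDomain S] [CharZero S] {x : S}
    {p a b c : ℤ} (hp : Prime p) (ha : p ∣ a) (hb : p ∣ b) (hc : p ∣ c) (hc2 : ¬ p ^ 2 ∣ c)
    (hx : x ^ 3 + a * x ^ 2 + b * x + c = 0) :
    IsIntegral ℤ x ∧ (minpoly ℤ x).IsEisensteinAt (Submodule.span ℤ {p}) := by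
  set f : ℤ[X] := X ^ 3 + C a * X ^ 2 + C b * X + C c with hf
  have hdeg : f.natDegree = 3 := by rw [hf]; compute_degree!
  have hmonic : f.Monic := by rw [hf]; monicity!
  have h0 : aeval x f = 0 := by simp [hf, hx]
  have hE : f.IsEisensteinAt (Submodule.span ℤ {p}) := by
    refine ⟨?_, fun {n} hn ↦ ?_, ?_⟩
    · rw [hmonic.leadingCoeff, Ideal.submodule_span_eq, Ideal.mem_span_singleton]
      exact fun h ↦ hp.not_isUnit (isUnit_of_dvd_one h)
    · rw [hdeg] at hn
      rw [Ideal.submodule_span_eq, Ideal.mem_span_singleton, hf]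
      interval_cases n <;> simp [-eq_intCast, coeff_X, coeff_C, *]
    · rw [Ideal.submodule_span_eq, Ideal.span_singleton_pow, Ideal.mem_span_singleton, hf]
      simpa using hc2
  have hint : IsIntegral ℤ x := ⟨f, hmonic, by simpa [aeval_def] using h0⟩
  have hirr : Irreducible f :=
    hE.irreducible ((Ideal.span_singleton_prime hp.ne_zero).2 hp) hmonic.isPrimitive (by omega)
  have hdvd : minpoly ℤ x ∣ f := minpoly.isIntegrallyClosed_dvd hint h0
  have : minpoly ℤ x = f :=
    eq_of_monic_of_associated (minpoly.monic hint) hmonic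
      ((hirr.dvd_iff.1 hdvd).resolve_left (minpoly.not_isUnit ℤ x)).symm
  exact ⟨hint, this ▸ hE⟩

/-- The cubic field `ℚ(∛11)`. -/
abbrev CubicField := AdjoinRoot cubicPoly

instance : NumberField CubicField where
  to_finiteDimensional := (AdjoinRoot.powerBasis fact_irreducible_cubicPoly.out.ne_zero).finite

open Algebra in
theorem mem_adjoin_of_isIntegral {K : Type*} [Field K] [NumberField K] (B : PowerBasis ℚ K)
    (hdim : B.dim = 3) (hgen : B.gen ^ 3 = 11) {z : K} (hz : IsIntegral ℤ z) :
    z ∈ adjoin ℤ {B.gen} := by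
  have hdiscr : Algebra.discr ℚ B.basis = -3267 := by
    rw [← discr_eq_of_pow_basis hgen (B.basis.reindex (finCongr hdim)) (by simp),
      ← Algebra.discr_reindex ℚ B.basis (finCongr hdim), B.basis.coe_reindex]
  obtain ⟨hint, hE⟩ := isEisensteinAt_minpoly_of_cubic (x := B.gen) (p := 11) (a := 0) (b := 0)
    (c := -11) (by norm_num) (by norm_num) (by norm_num) (by norm_num) (by norm_num)
    (by simp [hgen])
  let B' : PowerBasis ℚ K := .ofAdjoinEqTop (x := B.gen - 2) (.of_finite ℚ _) <|
    PowerBasis.adjoin_eq_top_of_gen_mem_adjoin (B := B) <| by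
      simpa using add_mem (self_mem_adjoin_singleton ℚ (B.gen - 2)) (ofNat_mem _ 2)
  have hB' : B'.gen = B.gen - 2 := by simp [B']
  obtain ⟨hint', hE'⟩ := isEisensteinAt_minpoly_of_cubic (x := B'.gen) (p := 3) (a := 6) (b := 12)
    (c := -3) (by norm_num) (by norm_num) (by norm_num) (by norm_num) (by norm_num)
    (by rw [hB']; push_cast; linear_combination hgen)
  have hadj : adjoin ℤ {B'.gen} = adjoin ℤ {B.gen} := by
    rw [hB']
    apply le_antisymm <;> refine adjoin_le (Set.singleton_subset_iff.2 ?_)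
    · exact sub_mem (self_mem_adjoin_singleton ℤ B.gen) (ofNat_mem _ 2)
    · simpa using add_mem (self_mem_adjoin_singleton ℤ (B.gen - 2)) (ofNat_mem _ 2)
  rw [← hadj]
  refine mem_adjoin_of_smul_prime_pow_smul_of_minpoly_isEisensteinAt (p := (3 : ℤ)) (n := 3)
    (by norm_num) hint' hz ?_ hE'
  rw [hadj]
  refine mem_adjoin_of_smul_prime_pow_smul_of_minpoly_isEisensteinAt (p := (11 : ℤ)) (n := 2)
    (by norm_num) hint (hz.smul _) ?_ hE
  convert neg_mem (discr_mul_isIntegral_mem_adjoin ℚ hint hz) using 1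
  rw [hdiscr]
  simp [Algebra.smul_def]
  ring

open Algebra in
theorem exists_integral_pow_basis {K : Type*} [Field K] [NumberField K] (B : PowerBasis ℚ K)
    (hdim : B.dim = 3) (hgen : B.gen ^ 3 = 11) :
    ∃ (θ : 𝓞 K) (b : Module.Basis (Fin 3) ℤ (𝓞 K)), θ ^ 3 = 11 ∧ ∀ i, b i = θ ^ (i : ℕ) := by
  have hint : IsIntegral ℤ B.gen :=
    ⟨X ^ 3 - C 11, monic_X_pow_sub_C _ (by norm_num), by simp [hgen]⟩
  let θ : 𝓞 K := ⟨B.gen, hint⟩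
  have hθ : θ ^ 3 = 11 := by
    apply RingOfIntegers.coe_injective
    rw [map_pow, map_ofNat]
    exact hgen
  have htop : adjoin ℤ {θ} = ⊤ := by
    refine _root_.eq_top_iff.2 fun z _ ↦ ?_
    have h := mem_adjoin_of_isIntegral B hdim hgen z.isIntegral_coe
    have hmap := (IsScalarTower.toAlgHom ℤ (𝓞 K) K).map_adjoin {θ}
    rw [Set.image_singleton] at hmap
    change (z : K) ∈ adjoin ℤ {IsScalarTower.toAlgHom ℤ (𝓞 K) K θ} at h
    rw [← hmap] at h
    obtain ⟨w, hw, hwz⟩ := h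
    rwa [← RingOfIntegers.ext (show (w : K) = z from hwz)]
  let P := PowerBasis.ofAdjoinEqTop' (RingOfIntegers.isIntegral θ) htop
  have hP : P.gen = θ := by simp [P]
  have hPdim : P.dim = 3 := by
    rw [← P.finrank, RingOfIntegers.rank, B.finrank, hdim]
  exact ⟨θ, P.basis.reindex (finCongr hPdim), hθ, by simp [hP]⟩

theorem exists_integral_pow_basis_cubicField :
    ∃ (θ : 𝓞 CubicField) (b : Module.Basis (Fin 3) ℤ (𝓞 CubicField)),
      θ ^ 3 = 11 ∧ ∀ i, b i = θ ^ (i : ℕ) := by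
  refine exists_integral_pow_basis
    (AdjoinRoot.powerBasis fact_irreducible_cubicPoly.out.ne_zero) ?_ ?_
  · rw [AdjoinRoot.powerBasis_dim]
    compute_degree!
  · have := AdjoinRoot.eval₂_root cubicPoly
    simpa [sub_eq_zero] using this

/-- The ring `R` is freely generated over `ℤ` by `1, θ, θ²`, where `θ³ = 11`. -/
structure IsCubicGenerator {R : Type*} [CommRing R] (θ : R) : Prop where
  pow_three : θ ^ 3 = 11
  exists_eq : ∀ z : R, ∃ a b c : ℤ, z = a + b * θ + c * θ ^ 2
  dvd_of_dvd : ∀ n a b c : ℤ, (n : R) ∣ a + b * θ + c * θ ^ 2 → n ∣ a ∧ n ∣ b ∧ n ∣ c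

namespace IsCubicGenerator

theorem of_basis {R : Type*} [CommRing R] {θ : R} (hθ : θ ^ 3 = 11) (b : Module.Basis (Fin 3) ℤ R)
    (hb : ∀ i, b i = θ ^ (i : ℕ)) : IsCubicGenerator θ where
  pow_three := hθ
  exists_eq z := by
    refine ⟨b.repr z 0, b.repr z 1, b.repr z 2, ?_⟩
    conv_lhs => rw [← b.sum_repr z]
    simp [Fin.sum_univ_three, hb]
  dvd_of_dvd n x y z := by
    rintro ⟨w, hw⟩
    have h : x • b 0 + y • b 1 + z • b 2 = n • w := by simpa [hb] using hw
    have h (i : Fin 3) := congrArg (fun v ↦ b.repr v i) h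
    exact ⟨⟨b.repr w 0, by simpa [-zsmul_eq_mul] using h 0⟩,
      ⟨b.repr w 1, by simpa [-zsmul_eq_mul] using h 1⟩,
      ⟨b.repr w 2, by simpa [-zsmul_eq_mul] using h 2⟩⟩

theorem dvd_of_intCast_mem {R : Type*} [CommRing R] {P : Ideal R} [hP : P.IsPrime] {p n : ℤ}
    (hp : Prime p) (hpP : (p : R) ∈ P) (hn : (n : R) ∈ P) : p ∣ n := by
  by_contra hpn
  obtain ⟨u, v, huv⟩ := (hp.irreducible.coprime_iff_not_dvd).2 hpn
  refine hP.ne_top ((Ideal.eq_top_iff_one P).2 ?_)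
  have := congrArg (Int.cast : ℤ → R) huv
  push_cast at this
  rw [← this]
  exact add_mem (P.mul_mem_left _ hpP) (P.mul_mem_left _ hn)

theorem eq_span_linear {R : Type*} [CommRing R] {θ : R} (h : IsCubicGenerator θ) {P : Ideal R}
    [P.IsPrime] {p r : ℤ} (hp : Prime p) (hpP : (p : R) ∈ P) (hr : θ - r ∈ P) :
    P = Ideal.span {(p : R), θ - r} := by
  refine le_antisymm (fun z hz ↦ ?_)
    (Ideal.span_le.2 (Set.insert_subset hpP (Set.singleton_subset_iff.2 hr)))
  obtain ⟨a, b, c, rfl⟩ := h.exists_eq z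
  have hm : ((a + b * r + c * r ^ 2 : ℤ) : R) ∈ P := by
    convert sub_mem hz (P.mul_mem_left (b + c * (θ + r)) hr) using 1
    push_cast
    ring
  obtain ⟨k, hk⟩ := dvd_of_intCast_mem hp hpP hm
  rw [Ideal.mem_span_pair]
  refine ⟨k, b + c * (θ + r), ?_⟩
  have := congrArg (Int.cast : ℤ → R) hk
  push_cast at this
  linear_combination -this

theorem eq_span_linear_of_dvd {R : Type*} [CommRing R] {θ : R} (h : IsCubicGenerator θ)
    {P : Ideal R} [P.IsPrime] {p r : ℤ} (hp : Prime p) (hpP : (p : R) ∈ P) (hr : θ - r ∈ P)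
    (hd : θ - r ∣ p) : P = Ideal.span {θ - r} := by
  rw [eq_span_linear h hp hpP hr, Ideal.span_insert, sup_eq_right,
    Ideal.span_singleton_le_span_singleton]
  exact hd

theorem eq_span_quadratic {R : Type*} [CommRing R] {θ : R} (h : IsCubicGenerator θ) {P : Ideal R}
    [P.IsPrime] {p : ℤ} (hp : Prime p) (hpP : (p : R) ∈ P) (hr : θ ^ 2 + θ + 1 ∈ P)
    (hinert : ∀ a b : ℤ, p ∣ a ^ 2 - a * b + b ^ 2 → p ∣ a ∧ p ∣ b) :
    P = Ideal.span {(p : R), θ ^ 2 + θ + 1} := by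
  refine le_antisymm (fun z hz ↦ ?_)
    (Ideal.span_le.2 (Set.insert_subset hpP (Set.singleton_subset_iff.2 hr)))
  obtain ⟨a, b, c, rfl⟩ := h.exists_eq z
  have hm : (((a - c) ^ 2 - (a - c) * (b - c) + (b - c) ^ 2 : ℤ) : R) ∈ P := by
    convert sub_mem (P.mul_mem_left ((a - c) - (b - c) - (b - c) * θ) hz)
      (P.mul_mem_left (((a - c) - (b - c) - (b - c) * θ) * c - (b - c) ^ 2) hr) using 1
    push_cast
    ring
  obtain ⟨⟨k, hk⟩, l, hl⟩ := hinert _ _ (dvd_of_intCast_mem hp hpP hm)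
  rw [Ideal.mem_span_pair]
  refine ⟨k + l * θ, c, ?_⟩
  have hk := congrArg (Int.cast : ℤ → R) hk
  have hl := congrArg (Int.cast : ℤ → R) hl
  push_cast at hk hl
  linear_combination -hk - θ * hl

theorem eq_span_inert {R : Type*} [CommRing R] {θ : R} (h : IsCubicGenerator θ) {P : Ideal R}
    [P.IsPrime] {p : ℤ} (hp : Prime p) (hpP : (p : R) ∈ P)
    (hinert : ∀ a b c : ℤ, p ∣ a ^ 3 + 11 * b ^ 3 + 121 * c ^ 3 - 33 * a * b * c →
      p ∣ a ∧ p ∣ b ∧ p ∣ c) :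
    P = Ideal.span {(p : R)} := by
  refine le_antisymm (fun z hz ↦ ?_) (Ideal.span_le.2 (Set.singleton_subset_iff.2 hpP))
  obtain ⟨a, b, c, rfl⟩ := h.exists_eq z
  have hm : ((a ^ 3 + 11 * b ^ 3 + 121 * c ^ 3 - 33 * a * b * c : ℤ) : R) ∈ P := by
    convert P.mul_mem_left
      ((a ^ 2 - 11 * b * c) + (11 * c ^ 2 - a * b) * θ + (b ^ 2 - a * c) * θ ^ 2) hz using 1
    push_cast
    linear_combination -(b * (b ^ 2 - a * c) + c * (11 * c ^ 2 - a * b)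
      + c * (b ^ 2 - a * c) * θ : R) * h.pow_three
  obtain ⟨⟨k, hk⟩, ⟨l, hl⟩, m, hm'⟩ := hinert _ _ _ (dvd_of_intCast_mem hp hpP hm)
  rw [Ideal.mem_span_singleton]
  refine ⟨k + l * θ + m * θ ^ 2, ?_⟩
  subst hk hl hm'
  push_cast
  ring

theorem span_two_sq {R : Type*} [CommRing R] {θ : R} (h : θ ^ 3 = 11) :
    Ideal.span {2, θ - 1} * Ideal.span {2, θ - 1} = Ideal.span {5 - θ ^ 2} := by
  apply le_antisymm
  · refine Ideal.mul_le.2 fun x hx y hy ↦ ?_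
    obtain ⟨a, b, rfl⟩ := Ideal.mem_span_pair.1 hx
    obtain ⟨c, d, rfl⟩ := Ideal.mem_span_pair.1 hy
    refine Ideal.mem_span_singleton.2 ⟨a * c * (25 + 11 * θ + 5 * θ ^ 2)
      + (a * d + b * c) * (15 + 7 * θ + 3 * θ ^ 2) + b * d * (9 + 4 * θ + 2 * θ ^ 2), ?_⟩
    linear_combination
      (a * c * (11 + 5 * θ) + (a * d + b * c) * (7 + 3 * θ) + b * d * (4 + 2 * θ)) * h
  · rw [Ideal.span_singleton_le_iff_mem]
    have h2 : (2 : R) ∈ Ideal.span {2, θ - 1} := Ideal.subset_span (by simp)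
    have h1 : θ - 1 ∈ Ideal.span {2, θ - 1} := Ideal.subset_span (by simp)
    convert sub_mem (sub_mem (Ideal.mul_mem_mul h2 h2) (Ideal.mul_mem_mul h2 h1))
      (Ideal.mul_mem_mul h1 h1) using 1
    ring

theorem span_five_mul_span_two {R : Type*} [CommRing R] {θ : R} (h : θ ^ 3 = 11) :
    Ideal.span {5, θ - 1} * Ideal.span {2, θ - 1} = Ideal.span {θ - 1} := by
  apply le_antisymm
  · refine Ideal.mul_le.2 fun x hx y hy ↦ ?_
    obtain ⟨a, b, rfl⟩ := Ideal.mem_span_pair.1 hx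
    obtain ⟨c, d, rfl⟩ := Ideal.mem_span_pair.1 hy
    refine Ideal.mem_span_singleton.2 ⟨a * c * (θ ^ 2 + θ + 1)
      + 5 * a * d + 2 * b * c + b * d * (θ - 1), ?_⟩
    linear_combination (-a * c) * h
  · rw [Ideal.span_singleton_le_iff_mem]
    have h5 : (5 : R) ∈ Ideal.span {5, θ - 1} := Ideal.subset_span (by simp)
    have h2 : (2 : R) ∈ Ideal.span {2, θ - 1} := Ideal.subset_span (by simp)
    have h1 : θ - 1 ∈ Ideal.span {2, θ - 1} := Ideal.subset_span (by simp)
    have h1' : θ - 1 ∈ Ideal.span {5, θ - 1} := Ideal.subset_span (by simp)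
    convert sub_mem (Ideal.mul_mem_mul h5 h1)
      (Ideal.mul_mem_left _ 2 (Ideal.mul_mem_mul h1' h2)) using 1
    ring

theorem span_quadratic_mul_span_linear {R : Type*} [CommRing R] {θ : R} (h : θ ^ 3 = 11)
    {p u v : R} (hp : p * (p * u) + 10 * v = p) (hp' : p ∣ 10) :
    Ideal.span {p, θ ^ 2 + θ + 1} * Ideal.span {p, θ - 1} = Ideal.span {p} := by
  apply le_antisymm
  · refine Ideal.mul_le.2 fun x hx y hy ↦ ?_
    obtain ⟨a, b, rfl⟩ := Ideal.mem_span_pair.1 hx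
    obtain ⟨c, d, rfl⟩ := Ideal.mem_span_pair.1 hy
    obtain ⟨q, hq⟩ := hp'
    refine Ideal.mem_span_singleton.2 ⟨a * c * p + a * d * (θ - 1) + b * c * (θ ^ 2 + θ + 1)
      + b * d * q, ?_⟩
    linear_combination b * d * h + b * d * hq
  · rw [Ideal.span_singleton_le_iff_mem]
    have h1 : p ∈ Ideal.span {p, θ ^ 2 + θ + 1} := Ideal.subset_span (by simp)
    have h2 : θ ^ 2 + θ + 1 ∈ Ideal.span {p, θ ^ 2 + θ + 1} := Ideal.subset_span (by simp)
    have h3 : p ∈ Ideal.span {p, θ - 1} := Ideal.subset_span (by simp)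
    have h4 : θ - 1 ∈ Ideal.span {p, θ - 1} := Ideal.subset_span (by simp)
    convert add_mem (Ideal.mul_mem_left _ u (Ideal.mul_mem_mul h1 h3))
      (Ideal.mul_mem_left _ v (Ideal.mul_mem_mul h2 h4)) using 1
    linear_combination -hp - v * h

theorem exists_prime_mem {R : Type*} [CommRing R] {P : Ideal R} [hP : P.IsPrime] {n : ℕ}
    (hn : n ≠ 0) (h : (n : R) ∈ P) : ∃ p : ℕ, p.Prime ∧ p ≤ n ∧ (p : R) ∈ P := by
  induction n using Nat.recOnMul with
  | zero => exact absurd rfl hn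
  | one => exact absurd ((Ideal.eq_top_iff_one P).2 (by simpa [-zsmul_eq_mul] using h)) hP.ne_top
  | prime p hp => exact ⟨p, hp, le_rfl, h⟩
  | mul a b iha ihb =>
    obtain ⟨ha, hb⟩ := mul_ne_zero_iff.1 hn
    rw [Nat.cast_mul] at h
    obtain h | h := hP.mem_or_mem h
    · obtain ⟨p, hp, hpa, hpP⟩ := iha ha h
      exact ⟨p, hp, hpa.trans (Nat.le_mul_of_pos_right _ (Nat.pos_of_ne_zero hb)), hpP⟩
    · obtain ⟨p, hp, hpa, hpP⟩ := ihb hb h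
      exact ⟨p, hp, hpa.trans (Nat.le_mul_of_pos_left _ (Nat.pos_of_ne_zero ha)), hpP⟩

theorem inert_seven (a b c : ℤ)
    (h : 7 ∣ a ^ 3 + 11 * b ^ 3 + 121 * c ^ 3 - 33 * a * b * c) :
    7 ∣ a ∧ 7 ∣ b ∧ 7 ∣ c := by
  have key : ∀ a b c : ZMod 7, a ^ 3 + 11 * b ^ 3 + 121 * c ^ 3 - 33 * a * b * c = 0 →
    a = 0 ∧ b = 0 ∧ c = 0 := by decide
  have := key a b c (by exact_mod_cast (ZMod.intCast_zmod_eq_zero_iff_dvd _ 7).2 h)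
  simpa [ZMod.intCast_zmod_eq_zero_iff_dvd] using this

set_option maxRecDepth 100000 in
theorem inert_thirteen (a b c : ℤ)
    (h : 13 ∣ a ^ 3 + 11 * b ^ 3 + 121 * c ^ 3 - 33 * a * b * c) :
    13 ∣ a ∧ 13 ∣ b ∧ 13 ∣ c := by
  have key : ∀ a b c : ZMod 13, a ^ 3 + 11 * b ^ 3 + 121 * c ^ 3 - 33 * a * b * c = 0 →
    a = 0 ∧ b = 0 ∧ c = 0 := by decide
  have := key a b c (by exact_mod_cast (ZMod.intCast_zmod_eq_zero_iff_dvd _ 13).2 h)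
  simpa [ZMod.intCast_zmod_eq_zero_iff_dvd] using this

theorem inert_quadratic_two (a b : ℤ) (h : 2 ∣ a ^ 2 - a * b + b ^ 2) : 2 ∣ a ∧ 2 ∣ b := by
  have key : ∀ a b : ZMod 2, a ^ 2 - a * b + b ^ 2 = 0 → a = 0 ∧ b = 0 := by decide
  have := key a b (by exact_mod_cast (ZMod.intCast_zmod_eq_zero_iff_dvd _ 2).2 h)
  simpa [ZMod.intCast_zmod_eq_zero_iff_dvd] using this

theorem inert_quadratic_five (a b : ℤ) (h : 5 ∣ a ^ 2 - a * b + b ^ 2) : 5 ∣ a ∧ 5 ∣ b := by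
  have key : ∀ a b : ZMod 5, a ^ 2 - a * b + b ^ 2 = 0 → a = 0 ∧ b = 0 := by decide
  have := key a b (by exact_mod_cast (ZMod.intCast_zmod_eq_zero_iff_dvd _ 5).2 h)
  simpa [ZMod.intCast_zmod_eq_zero_iff_dvd] using this

theorem linear_mem_or_quadratic_mem {R : Type*} [CommRing R] {θ : R} (hθ : θ ^ 3 = 11)
    {P : Ideal R} [hP : P.IsPrime] (hmem : (10 : R) ∈ P) : θ - 1 ∈ P ∨ θ ^ 2 + θ + 1 ∈ P :=
  hP.mem_or_mem (by convert hmem using 1; linear_combination hθ)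

section ClassGroup

variable {R : Type*} [CommRing R] [IsDedekindDomain R]

theorem mk0_sq_eq_one_of_mul_eq_span {I J : (Ideal R)⁰} {x : R}
    (hIJ : (I * J : Ideal R) = Ideal.span {x}) (hJ : ClassGroup.mk0 J ^ 2 = 1) :
    ClassGroup.mk0 I ^ 2 = 1 := by
  have : ClassGroup.mk0 (I * J) = 1 :=
    (ClassGroup.mk0_eq_one_iff (I * J).2).2 (by rw [Submonoid.coe_mul, hIJ]; exact ⟨x, rfl⟩)
  rw [map_mul] at this
  rw [eq_inv_of_mul_eq_one_left this, inv_pow, hJ, inv_one]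

theorem mk0_sq_eq_one_of_eq_span {I : (Ideal R)⁰} {x : R} (hI : (I : Ideal R) = Ideal.span {x}) :
    ClassGroup.mk0 I ^ 2 = 1 := by
  rw [(ClassGroup.mk0_eq_one_iff I.2).2 (by rw [hI]; exact ⟨x, rfl⟩), one_pow]

theorem span_pair_mem_nonZeroDivisors {x : R} (hx : x ≠ 0) (y : R) :
    Ideal.span {x, y} ∈ (Ideal R)⁰ := by
  refine mem_nonZeroDivisors_of_ne_zero fun h0 ↦ hx ?_
  have : x ∈ Ideal.span {x, y} := Ideal.subset_span (by simp)
  rwa [h0] at this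

theorem mk0_sq_eq_one_of_eq_span_two {θ : R} (hθ : θ ^ 3 = 11) {I : (Ideal R)⁰}
    (hI : (I : Ideal R) = Ideal.span {2, θ - 1}) : ClassGroup.mk0 I ^ 2 = 1 := by
  rw [sq, ← map_mul, ClassGroup.mk0_eq_one_iff, Submonoid.coe_mul, hI]
  exact ⟨_, span_two_sq hθ⟩

theorem mk0_sq_eq_one_of_mul_span_two_eq [CharZero R] {θ : R} (hθ : θ ^ 3 = 11) {I : (Ideal R)⁰}
    {x : R} (hI : (I : Ideal R) * Ideal.span {2, θ - 1} = Ideal.span {x}) :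
    ClassGroup.mk0 I ^ 2 = 1 :=
  mk0_sq_eq_one_of_mul_eq_span (J := ⟨_, span_pair_mem_nonZeroDivisors two_ne_zero _⟩) hI
    (mk0_sq_eq_one_of_eq_span_two hθ rfl)

theorem mk0_sq_eq_one_of_eq_span_five [CharZero R] {θ : R} (hθ : θ ^ 3 = 11) {I : (Ideal R)⁰}
    (hI : (I : Ideal R) = Ideal.span {5, θ - 1}) : ClassGroup.mk0 I ^ 2 = 1 :=
  mk0_sq_eq_one_of_mul_span_two_eq hθ (by rw [hI, span_five_mul_span_two hθ])

theorem mk0_sq_eq_one_of_mul_span_five_eq [CharZero R] {θ : R} (hθ : θ ^ 3 = 11) {I : (Ideal R)⁰}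
    {x : R} (hI : (I : Ideal R) * Ideal.span {5, θ - 1} = Ideal.span {x}) :
    ClassGroup.mk0 I ^ 2 = 1 :=
  mk0_sq_eq_one_of_mul_eq_span
    (J := ⟨_, span_pair_mem_nonZeroDivisors (OfNat.ofNat_ne_zero 5) _⟩) hI
    (mk0_sq_eq_one_of_eq_span_five hθ rfl)

theorem mk0_sq_eq_one_of_two_mem [CharZero R] {θ : R} (h : IsCubicGenerator θ) (P : (Ideal R)⁰)
    [hP : (P : Ideal R).IsPrime] (hpP : (2 : R) ∈ (P : Ideal R)) : ClassGroup.mk0 P ^ 2 = 1 := by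
  have hθ := h.pow_three
  have hpP' : ((2 : ℤ) : R) ∈ (P : Ideal R) := by rwa [Int.cast_ofNat]
  obtain hd | hd := linear_mem_or_quadratic_mem hθ (P := P)
    (by convert (P : Ideal R).mul_mem_left 5 hpP using 1; norm_num)
  · have := eq_span_linear h Int.prime_two hpP' (r := 1) (by rwa [Int.cast_one])
    rw [Int.cast_one, Int.cast_ofNat] at this
    exact mk0_sq_eq_one_of_eq_span_two hθ this
  · refine mk0_sq_eq_one_of_mul_span_two_eq hθ (x := 2) ?_
    rw [eq_span_quadratic h Int.prime_two hpP' hd inert_quadratic_two, Int.cast_ofNat]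
    exact span_quadratic_mul_span_linear (u := -2) (v := 1) hθ (by norm_num) ⟨5, by norm_num⟩

theorem mk0_sq_eq_one_of_five_mem [CharZero R] {θ : R} (h : IsCubicGenerator θ) (P : (Ideal R)⁰)
    [hP : (P : Ideal R).IsPrime] (hpP : (5 : R) ∈ (P : Ideal R)) : ClassGroup.mk0 P ^ 2 = 1 := by
  have hθ := h.pow_three
  have hp : Prime (5 : ℤ) := by norm_num
  have hpP' : ((5 : ℤ) : R) ∈ (P : Ideal R) := by rwa [Int.cast_ofNat]
  obtain hd | hd := linear_mem_or_quadratic_mem hθ (P := P)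
    (by convert (P : Ideal R).mul_mem_left 2 hpP using 1; norm_num)
  · have := eq_span_linear h hp hpP' (r := 1) (by rwa [Int.cast_one])
    rw [Int.cast_one, Int.cast_ofNat] at this
    exact mk0_sq_eq_one_of_eq_span_five hθ this
  · refine mk0_sq_eq_one_of_mul_span_five_eq hθ (x := 5) ?_
    rw [eq_span_quadratic h hp hpP' hd inert_quadratic_five, Int.cast_ofNat]
    exact span_quadratic_mul_span_linear (u := 1) (v := -2) hθ (by norm_num) ⟨2, by norm_num⟩

theorem mk0_sq_eq_one_of_three_mem {θ : R} (h : IsCubicGenerator θ) (P : (Ideal R)⁰)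
    [hP : (P : Ideal R).IsPrime] (hpP : (3 : R) ∈ (P : Ideal R)) : ClassGroup.mk0 P ^ 2 = 1 := by
  have hθ := h.pow_three
  refine mk0_sq_eq_one_of_eq_span (eq_span_linear_of_dvd h (p := 3) (r := 2) (by norm_num)
    (by rwa [Int.cast_ofNat]) ?_ ⟨θ ^ 2 + 2 * θ + 4, by push_cast; linear_combination -hθ⟩)
  refine hP.mem_of_pow_mem 3 ?_
  convert (P : Ideal R).mul_mem_left (1 - 2 * θ ^ 2 + 4 * θ) hpP using 1
  push_cast
  linear_combination hθ

theorem mk0_sq_eq_one_of_eleven_mem {θ : R} (h : IsCubicGenerator θ) (P : (Ideal R)⁰)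
    [hP : (P : Ideal R).IsPrime] (hpP : (11 : R) ∈ (P : Ideal R)) :
    ClassGroup.mk0 P ^ 2 = 1 := by
  have hθ := h.pow_three
  refine mk0_sq_eq_one_of_eq_span (eq_span_linear_of_dvd h (p := 11) (r := 0) (by norm_num)
    (by rwa [Int.cast_ofNat]) ?_ ⟨θ ^ 2, by push_cast; linear_combination -hθ⟩)
  refine hP.mem_of_pow_mem 3 ?_
  convert hpP using 1
  push_cast
  linear_combination hθ

theorem mk0_sq_eq_one_of_isPrime [CharZero R] {θ : R} (h : IsCubicGenerator θ) (P : (Ideal R)⁰)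
    [hP : (P : Ideal R).IsPrime]
    {p : ℕ} (hp : p.Prime) (hp16 : p ≤ 16)
    (hpP : (p : R) ∈ (P : Ideal R)) : ClassGroup.mk0 P ^ 2 = 1 := by
  have hcases : p = 2 ∨ p = 3 ∨ p = 5 ∨ p = 7 ∨ p = 11 ∨ p = 13 := by
    clear hpP
    interval_cases p <;> revert hp <;> norm_num
  obtain rfl | rfl | rfl | rfl | rfl | rfl := hcases <;> rw [Nat.cast_ofNat] at hpP
  · exact mk0_sq_eq_one_of_two_mem h P hpP
  · exact mk0_sq_eq_one_of_three_mem h P hpP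
  · exact mk0_sq_eq_one_of_five_mem h P hpP
  · exact mk0_sq_eq_one_of_eq_span
      (eq_span_inert h (p := 7) (by norm_num) (by rwa [Int.cast_ofNat]) inert_seven)
  · exact mk0_sq_eq_one_of_eleven_mem h P hpP
  · exact mk0_sq_eq_one_of_eq_span
      (eq_span_inert h (p := 13) (by norm_num) (by rwa [Int.cast_ofNat]) inert_thirteen)

end ClassGroup

theorem mk0_sq_eq_one_of_absNorm_le {R : Type*} [CommRing R] [IsDedekindDomain R]
    [Module.Free ℤ R] [Module.Finite ℤ R] [CharZero R] {θ : R} (h : IsCubicGenerator θ)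
    (I : Ideal R) (hI : I ∈ (Ideal R)⁰) (hle : Ideal.absNorm I ≤ 16) :
    ClassGroup.mk0 ⟨I, hI⟩ ^ 2 = 1 := by
  induction I using UniqueFactorizationMonoid.induction_on_prime with
  | h₁ => exact absurd rfl (nonZeroDivisors.ne_zero hI)
  | h₂ I hu =>
    refine mk0_sq_eq_one_of_eq_span (x := 1) ?_
    simpa using Ideal.isUnit_iff.1 hu
  | h₃ J P hJ hP ih =>
    have hJ' := mem_nonZeroDivisors_of_ne_zero hJ
    have hP' := mem_nonZeroDivisors_of_ne_zero hP.ne_zero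
    have posJ := Nat.pos_of_ne_zero (Ideal.absNorm_eq_zero_iff.not.2 hJ)
    have posP := Nat.pos_of_ne_zero (Ideal.absNorm_eq_zero_iff.not.2 hP.ne_zero)
    rw [map_mul] at hle
    have : ClassGroup.mk0 ⟨P * J, hI⟩ = ClassGroup.mk0 ⟨P, hP'⟩ * ClassGroup.mk0 ⟨J, hJ'⟩ := by
      rw [← map_mul]
      rfl
    rw [this, mul_pow, ih hJ' ((Nat.le_mul_of_pos_left _ posP).trans hle), mul_one]
    have := Ideal.isPrime_of_prime hP
    obtain ⟨p, hp, hple, hpP⟩ := exists_prime_mem posP.ne' (Ideal.absNorm_mem P)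
    exact mk0_sq_eq_one_of_isPrime h ⟨P, hP'⟩ (hP := this) hp
      (hple.trans ((Nat.le_mul_of_pos_right _ posJ).trans hle)) hpP

section NumberField

open NumberField.InfinitePlace Module

variable {K : Type*} [Field K] [NumberField K]

theorem discr_eq {θ : 𝓞 K} (hθ : θ ^ 3 = 11) (b : Basis (Fin 3) ℤ (𝓞 K))
    (hb : ∀ i, b i = θ ^ (i : ℕ)) : discr K = -3267 := by
  rw [← NumberField.discr_eq_discr K b, discr_eq_of_pow_basis hθ b hb]

theorem finrank_eq_three (b : Basis (Fin 3) ℤ (𝓞 K)) : finrank ℚ K = 3 := by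
  rw [← RingOfIntegers.rank, finrank_eq_card_basis b, Fintype.card_fin]

theorem nrComplexPlaces_eq_one (hdisc : discr K < 0) (hrank : finrank ℚ K = 3) :
    nrComplexPlaces K = 1 := by
  have h := card_add_two_mul_card_eq_rank K
  have hs := sign_discr K
  rw [Int.sign_eq_neg_one_of_neg hdisc] at hs
  have : nrComplexPlaces K ≠ 0 := by
    intro h0
    rw [h0] at hs
    norm_num at hs
  omega

theorem unitRank_eq_one (hdisc : discr K < 0) (hrank : finrank ℚ K = 3) :
    Units.rank K = 1 := by
  have h := card_add_two_mul_card_eq_rank K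
  have h1 := nrComplexPlaces_eq_one hdisc hrank
  rw [Units.rank, card_eq_nrRealPlaces_add_nrComplexPlaces]
  omega

theorem minkowskiBound_lt (hdisc : discr K = -3267) (hrank : finrank ℚ K = 3) :
    (4 / Real.pi) ^ nrComplexPlaces K *
      ((finrank ℚ K).factorial / (finrank ℚ K) ^ (finrank ℚ K) * √|discr K|) < 17 := by
  rw [nrComplexPlaces_eq_one (by omega) hrank, hdisc, hrank]
  have hsqrt : √(3267 : ℝ) < 58 := by
    rw [Real.sqrt_lt' (by norm_num)]
    norm_num
  have hpi := Real.pi_gt_three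
  rw [pow_one, div_mul_eq_mul_div, div_lt_iff₀ Real.pi_pos]
  simp only [Nat.factorial]
  norm_num [abs_of_neg]
  have := Real.pi_gt_d2
  linarith

theorem classGroup_sq_eq_one {θ : 𝓞 K} (h : IsCubicGenerator θ) (hdisc : discr K = -3267)
    (hrank : finrank ℚ K = 3) (C : ClassGroup (𝓞 K)) : C ^ 2 = 1 := by
  obtain ⟨I, rfl, hI⟩ := NumberField.exists_ideal_in_class_of_norm_le C
  have : (Ideal.absNorm (I : Ideal (𝓞 K)) : ℝ) < 17 := hI.trans_lt (minkowskiBound_lt hdisc hrank)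
  exact mk0_sq_eq_one_of_absNorm_le h I I.2 (Nat.lt_succ_iff.1 (by exact_mod_cast this))

theorem exists_eq_unit_mul_pow_eleven {θ : 𝓞 K} (h : IsCubicGenerator θ) (hdisc : discr K = -3267)
    (hrank : finrank ℚ K = 3) {x : 𝓞 K} (hx : x ≠ 0) {I : Ideal (𝓞 K)}
    (hI : Ideal.span {x} = I ^ 11) : ∃ (u : (𝓞 K)ˣ) (β : 𝓞 K), x = u * β ^ 11 := by
  have hI0 : I ≠ 0 := by
    rintro rfl
    rw [zero_pow (by norm_num)] at hI
    exact hx (Ideal.span_singleton_eq_bot.1 hI)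
  have hI' := mem_nonZeroDivisors_of_ne_zero hI0
  have h11 : ClassGroup.mk0 ⟨I, hI'⟩ ^ 11 = 1 := by
    rw [← map_pow, ClassGroup.mk0_eq_one_iff, SubmonoidClass.coe_pow, ← hI]
    exact ⟨x, rfl⟩
  have h1 : ClassGroup.mk0 ⟨I, hI'⟩ = 1 := by
    rw [show 11 = 2 * 5 + 1 from rfl, pow_succ, pow_mul,
      classGroup_sq_eq_one h hdisc hrank, one_pow, one_mul] at h11
    exact h11
  obtain ⟨β, rfl⟩ := (ClassGroup.mk0_eq_one_iff hI').1 h1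
  rw [Ideal.submodule_span_eq, Ideal.span_singleton_pow,
    Ideal.span_singleton_eq_span_singleton] at hI
  obtain ⟨u, hu⟩ := hI.symm
  exact ⟨u, β, by rw [← hu, mul_comm]⟩

theorem exists_unit_eq_neg_one_pow_mul (hdisc : discr K = -3267) (hrank : finrank ℚ K = 3) :
    ∃ η : (𝓞 K)ˣ, ∀ u : (𝓞 K)ˣ, ∃ n : ℤ, u = η ^ n ∨ u = -η ^ n := by
  have hr := unitRank_eq_one (K := K) (by omega) hrank
  refine ⟨Units.fundSystem K ⟨0, by omega⟩, fun u ↦ ?_⟩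
  obtain ⟨⟨ζ, e⟩, he, -⟩ := Units.exist_unique_eq_mul_prod K u
  have : Unique (Fin (Units.rank K)) := hr ▸ inferInstance
  rw [Fintype.prod_subsingleton _ ⟨0, by omega⟩] at he
  refine ⟨e ⟨0, by omega⟩, ?_⟩
  rcases Units.torsion_eq_one_or_neg_one_of_odd_finrank (by rw [hrank]; decide) ζ with hζ | hζ
  · left
    simpa [hζ] using he
  · right
    simpa [hζ] using he

end NumberField

section ModEleven

variable {R : Type*} [CommRing R] {θ : R}

/-- Reduction modulo `11`. -/
abbrev modEleven : R →+* R ⧸ Ideal.span {(11 : R)} := Ideal.Quotient.mk _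

theorem mk_eleven_eq_zero_iff {x : R} : modEleven x = 0 ↔ 11 ∣ x := by
  rw [Ideal.Quotient.eq_zero_iff_mem, Ideal.mem_span_singleton]

theorem eleven_eq_zero : (11 : R ⧸ Ideal.span {(11 : R)}) = 0 := by
  rw [← map_ofNat (modEleven (R := R)), mk_eleven_eq_zero_iff]

theorem mk_pow_three_eq_zero (h : IsCubicGenerator θ) : modEleven θ ^ 3 = 0 := by
  rw [← map_pow, h.pow_three, mk_eleven_eq_zero_iff]

theorem exists_mk_pow_eleven_eq (h : IsCubicGenerator θ) (w : R) :
    ∃ m : ℤ, modEleven (w ^ 11) = m := by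
  obtain ⟨a, b, c, rfl⟩ := h.exists_eq w
  obtain ⟨r, hr⟩ := exists_add_pow_prime_eq (p := 11) (by norm_num) (a : R) ((b + c * θ) * θ)
  refine ⟨a ^ 11, ?_⟩
  rw [show (a : R) + b * θ + c * θ ^ 2 = a + (b + c * θ) * θ by ring, hr]
  simp only [map_add, map_mul, map_pow, map_natCast, map_intCast]
  push_cast
  linear_combination
    (a * (b + c * modEleven θ) * modEleven θ * modEleven r) * eleven_eq_zero (R := R) +
    ((b + c * modEleven θ) ^ 11 * modEleven θ ^ 8) * mk_pow_three_eq_zero h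

/-- The unit `1 + 4θ - 2θ²`. -/
def unit (h : IsCubicGenerator θ) : Rˣ where
  val := 1 + 4 * θ - 2 * θ ^ 2
  inv := 89 + 40 * θ + 18 * θ ^ 2
  val_inv := by linear_combination (-8 - 36 * θ) * h.pow_three
  inv_val := by linear_combination (-8 - 36 * θ) * h.pow_three

theorem mk_unit_pow (h : IsCubicGenerator θ) (r : ℕ) :
    modEleven ((h.unit : R) ^ r) =
      1 + 4 * r * modEleven θ + (8 * r ^ 2 - 10 * r) * modEleven θ ^ 2 := by
  induction r with
  | zero => simp
  | succ r ih =>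
    rw [pow_succ, map_mul, ih]
    simp only [unit, map_add, map_sub, map_mul, map_pow, map_ofNat, map_one]
    push_cast
    linear_combination
      (-8 * r + 4 * (8 * r ^ 2 - 10 * r) - 2 * (8 * r ^ 2 - 10 * r) * modEleven θ) *
        mk_pow_three_eq_zero h

theorem unit_ne_pow_eleven (h : IsCubicGenerator θ) (v : Rˣ) : h.unit ≠ v ^ 11 := by
  intro hv
  obtain ⟨m, hm⟩ := h.exists_mk_pow_eleven_eq v
  rw [← Units.val_pow_eq_pow_val, ← hv] at hm
  have : ((11 : ℤ) : R) ∣ (1 - m : ℤ) + (4 : ℤ) * θ + (-2 : ℤ) * θ ^ 2 := by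
    rw [Int.cast_ofNat, ← mk_eleven_eq_zero_iff, ← sub_eq_zero.2 hm]
    simp only [unit, map_add, map_sub, map_mul, map_pow, map_intCast, map_ofNat, map_one]
    push_cast
    ring
  have := (h.dvd_of_dvd _ _ _ _ this).2.1
  norm_num at this

theorem not_linear_eq (h : IsCubicGenerator θ) {x y : ℤ} (hx : ¬ 11 ∣ x) (r : ℕ) (w : R) :
    (x : R) + y * θ ≠ (100 + θ ^ 2) ^ 6 * (h.unit : R) ^ r * w ^ 11 := by
  intro heq
  obtain ⟨m, hm⟩ := h.exists_mk_pow_eleven_eq w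
  have hπ : modEleven ((100 + θ ^ 2) ^ 6) = 1 + 6 * modEleven θ ^ 2 := by
    simp only [map_pow, map_add, map_ofNat]
    have h100 : (100 : R ⧸ Ideal.span {(11 : R)}) = 1 := by
      linear_combination 9 * eleven_eq_zero (R := R)
    rw [h100]
    linear_combination (modEleven θ * (15 + 20 * modEleven θ ^ 2 + 15 * modEleven θ ^ 4
      + 6 * modEleven θ ^ 6 + modEleven θ ^ 8)) *
      mk_pow_three_eq_zero h
  have hdvd : ((11 : ℤ) : R) ∣ (x - m : ℤ) + (y - 4 * r * m : ℤ) * θ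
      + (-((8 * r ^ 2 - 10 * r + 6) * m) : ℤ) * θ ^ 2 := by
    rw [Int.cast_ofNat, ← mk_eleven_eq_zero_iff]
    have := congrArg modEleven heq
    rw [map_mul, map_mul, hπ, mk_unit_pow, hm] at this
    simp only [map_add, map_mul, map_pow, map_intCast] at this ⊢
    push_cast
    linear_combination this + m * (24 * r + 6 * (8 * r ^ 2 - 10 * r) * modEleven θ) *
      mk_pow_three_eq_zero h
  obtain ⟨h0, -, h2⟩ := h.dvd_of_dvd _ _ _ _ hdvd
  rw [dvd_neg] at h2
  obtain h2 | h2 := (show Prime (11 : ℤ) by norm_num).dvd_or_dvd h2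
  · have key : ∀ t : ZMod 11, 8 * t ^ 2 - 10 * t + 6 ≠ 0 := by decide
    exact key r (by exact_mod_cast (ZMod.intCast_zmod_eq_zero_iff_dvd _ 11).2 h2)
  · exact hx (by simpa using dvd_add h0 h2)

end ModEleven

/-- If every element of a commutative group is, up to an element of order `2`, a power of `η`, and
`ε` is not an eleventh power, then `ε` generates the group modulo eleventh powers. -/
theorem exists_eq_pow_mul_pow_eleven {G : Type*} [CommGroup G] {η ε : G}
    (hη : ∀ u : G, ∃ n : ℤ, u ^ 2 = η ^ n) (hε : ∀ v : G, ε ≠ v ^ 11) (u : G) :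
    ∃ (r : ℕ) (v : G), u = ε ^ r * v ^ 11 := by
  obtain ⟨j, hj⟩ := hη ε
  have hj11 : ¬ (11 : ℤ) ∣ j := by
    rintro ⟨i, rfl⟩
    refine hε (η ^ (-5 * i) * ε) ?_
    calc ε = (ε ^ 2) ^ (-5 : ℤ) * ε ^ 11 := by group
      _ = (η ^ (-5 * i) * ε) ^ 11 := by
        rw [hj, mul_pow, ← zpow_mul, ← zpow_natCast (η ^ (-5 * i)), ← zpow_mul]
        congr 2
        push_cast
        ring
  obtain ⟨t, s, hst⟩ :=
    ((show Prime (11 : ℤ) by norm_num).irreducible.coprime_iff_not_dvd).2 hj11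
  obtain ⟨n, hn⟩ := hη u
  obtain ⟨m, hm⟩ : ∃ m, m = -5 * n := ⟨_, rfl⟩
  have hr : ((2 * m * s % 11).toNat : ℤ) = 2 * m * s % 11 := Int.toNat_of_nonneg (by omega)
  refine ⟨(2 * m * s % 11).toNat, ε ^ (2 * m * s / 11) * η ^ (m * t) * u, ?_⟩
  calc u = (u ^ 2) ^ (-5 : ℤ) * u ^ 11 := by group
    _ = (η ^ j) ^ (m * s) * (η ^ (m * t)) ^ 11 * u ^ 11 := by
      rw [hn, ← zpow_mul, ← zpow_mul, ← zpow_natCast (η ^ (m * t)), ← zpow_mul, ← zpow_add]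
      congr 2
      push_cast
      linear_combination -m * hst - hm
    _ = ε ^ (2 * m * s) * (η ^ (m * t)) ^ 11 * u ^ 11 := by
      rw [← hj, ← zpow_natCast ε 2, ← zpow_mul]
      congr 3
      push_cast
      ring
    _ = ε ^ (2 * m * s % 11) * ε ^ (11 * (2 * m * s / 11)) * (η ^ (m * t)) ^ 11 * u ^ 11 := by
      rw [← zpow_add, Int.emod_add_mul_ediv]
    _ = _ := by
      rw [mul_pow, mul_pow, ← zpow_natCast ε, hr, mul_comm 11, zpow_mul, zpow_ofNat,
        ← mul_assoc, ← mul_assoc]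

theorem isCoprime_linear_quadratic {R : Type*} [CommRing R] {θ : R} (hθ : θ ^ 3 = 11) {x y : ℤ}
    (hxy : IsCoprime x y) (h11 : ¬ 11 ∣ x) (h3 : ¬ 3 ∣ x ^ 3 + 11 * y ^ 3) :
    IsCoprime ((x : R) + y * θ) (x ^ 2 - x * y * θ + y ^ 2 * θ ^ 2) := by
  have cast_coprime {a b : ℤ} (hab : IsCoprime a b) : IsCoprime (a : R) (b : R) := by
    simpa using hab.map (Int.castRingHom R)
  have hA3 : IsCoprime ((x : R) + y * θ) 3 := by
    have h := cast_coprime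
      (((show Prime (3 : ℤ) by norm_num).irreducible.coprime_iff_not_dvd).2 h3).symm
    rw [Int.cast_ofNat] at h
    refine h.of_isCoprime_of_dvd_left ⟨x ^ 2 - x * y * θ + y ^ 2 * θ ^ 2, ?_⟩
    push_cast
    linear_combination -(y ^ 3 : R) * hθ
  have hAy : IsCoprime ((x : R) + y * θ) y := by
    simpa using (cast_coprime hxy).add_mul_left_left θ
  have hAθ : IsCoprime ((x : R) + y * θ) θ := by
    have h := cast_coprime
      (((show Prime (11 : ℤ) by norm_num).irreducible.coprime_iff_not_dvd).2 h11).symm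
    rw [Int.cast_ofNat] at h
    have h := h.of_isCoprime_of_dvd_right (x := θ) ⟨θ ^ 2, by linear_combination -hθ⟩
    simpa [mul_comm] using h.add_mul_left_left (y : R)
  have := (hA3.mul_right (hAy.pow_right (n := 2))).mul_right (hAθ.pow_right (n := 2))
  convert this.add_mul_left_right (x - 2 * y * θ) using 1
  ring

theorem exists_factorization {R : Type*} [CommRing R] [IsDomain R] [CharZero R] {θ : R}
    (hθ : θ ^ 3 = 11) {x y z : ℤ}
    (heq : x ^ 3 + 11 * y ^ 3 = 1000121 ^ 6 * z ^ 11) (hp : 1000121 ∣ 100 * x - 11 * y)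
    (hcop : IsCoprime ((x : R) + y * θ) (x ^ 2 - x * y * θ + y ^ 2 * θ ^ 2)) :
    ∃ α β : R, (x : R) + y * θ = (100 + θ ^ 2) ^ 6 * α ∧ IsCoprime α β ∧ α * β = z ^ 11 := by
  set A := (x : R) + y * θ with hA
  set B := (x : R) ^ 2 - x * y * θ + y ^ 2 * θ ^ 2 with hB
  set π := 100 + θ ^ 2 with hπ
  set π' := 10000 + 11 * θ - 100 * θ ^ 2 with hπ'
  have hππ' : π * π' = 1000121 := by
    rw [hπ, hπ']
    linear_combination (11 - 100 * θ) * hθ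
  have hAB : A * B = π ^ 6 * (π' ^ 6 * z ^ 11) := by
    have := congrArg (Int.cast : ℤ → R) heq
    push_cast at this
    rw [← mul_assoc, ← mul_pow, hππ', hA, hB]
    linear_combination this + (y ^ 3 : R) * hθ
  obtain ⟨k, hk⟩ := hp
  have hk : (100 : R) * x - 11 * y = π * π' * k := by
    rw [hππ']
    exact_mod_cast congrArg (Int.cast : ℤ → R) hk
  have hunit : IsCoprime (π * π') (100 : R) := by
    rw [hππ']
    have : IsCoprime (1000121 : ℤ) 100 := by rw [Int.isCoprime_iff_gcd_eq_one]; rfl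
    simpa using this.map (Int.castRingHom R)
  have hπA : π ∣ A := by
    refine hunit.of_mul_left_left.dvd_of_dvd_mul_left ⟨y * θ + π' * k, ?_⟩
    rw [hA]
    linear_combination hk - (y : R) * hθ + y * θ * hπ
  have hπ'B : π' ∣ B := by
    refine (hunit.of_mul_left_right.pow_right (n := 2)).dvd_of_dvd_mul_left
      ⟨-100 * y ^ 2 + π * k * (100 * x + 11 * y - 100 * y * θ) + y ^ 2 * π, ?_⟩
    rw [hB]
    linear_combination (100 * x + 11 * y - 100 * y * θ : R) * hk - y ^ 2 * hππ'
      - 100 * (y ^ 2 : R) * hπ'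
  have hAπ' : IsCoprime A π' := hcop.of_isCoprime_of_dvd_right hπ'B
  have hBπ : IsCoprime B π := hcop.symm.of_isCoprime_of_dvd_right hπA
  obtain ⟨α, hα⟩ : π ^ 6 ∣ A :=
    (hBπ.symm.pow_left (m := 6)).dvd_of_dvd_mul_right ⟨_, hAB⟩
  obtain ⟨β, hβ⟩ : π' ^ 6 ∣ B :=
    (hAπ'.symm.pow_left (m := 6)).dvd_of_dvd_mul_left ⟨π ^ 6 * z ^ 11, by rw [hAB]; ring⟩
  refine ⟨α, β, hα, ?_, ?_⟩
  · rw [hα, hβ] at hcop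
    exact hcop.of_mul_left_right.of_mul_right_right
  · rw [hα, hβ] at hAB
    have h0 : (π * π') ^ 6 ≠ 0 := pow_ne_zero _ (by rw [hππ']; exact OfNat.ofNat_ne_zero _)
    apply mul_left_cancel₀ h0
    linear_combination hAB

theorem exists_span_eq_pow {R : Type*} [CommRing R] [IsDedekindDomain R] {α β z : R} {n : ℕ}
    (hcop : IsCoprime α β) (h : α * β = z ^ n) : ∃ I : Ideal R, Ideal.span {α} = I ^ n := by
  classical
  refine exists_eq_pow_of_mul_eq_pow_of_coprime (b := Ideal.span {β}) (c := Ideal.span {z}) ?_ ?_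
  · rwa [Ideal.isCoprime_span_singleton_iff]
  · rw [Ideal.span_singleton_mul_span_singleton, h, Ideal.span_singleton_pow]

theorem pow_three_injective {p k : ℕ} [Fact p.Prime] (hk : 3 * k = p + (p - 1)) :
    Function.Injective fun u : ZMod p ↦ u ^ 3 := by
  refine Function.LeftInverse.injective (g := fun u ↦ u ^ k) fun w ↦ ?_
  change (w ^ 3) ^ k = w
  rw [← pow_mul, hk, pow_add, ZMod.pow_card, mul_pow_sub_one (Fact.out : p.Prime).ne_zero,
    ZMod.pow_card]

theorem dvd_hundred_mul_sub {p k : ℕ} [Fact p.Prime] (hk : 3 * k = p + (p - 1))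
    (hp : p = 100 ^ 3 + 11 ^ 2) {x y : ℤ} (h : (p : ℤ) ∣ x ^ 3 + 11 * y ^ 3) :
    (p : ℤ) ∣ 100 * x - 11 * y := by
  rw [← ZMod.intCast_zmod_eq_zero_iff_dvd] at h ⊢
  have h0 := congrArg (Nat.cast : ℕ → ZMod p) hp
  push_cast [ZMod.natCast_self] at h h0 ⊢
  refine sub_eq_zero.2 (pow_three_injective hk ?_)
  change _ ^ 3 = _ ^ 3
  linear_combination (-121) * h - x ^ 3 * h0

theorem not_dvd_three {x y z : ℤ} (hxy : IsCoprime x y)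
    (heq : x ^ 3 + 11 * y ^ 3 = 1000121 ^ 6 * z ^ 11) : ¬ 3 ∣ x ^ 3 + 11 * y ^ 3 := by
  intro h
  have h3 : Prime (3 : ℤ) := by norm_num
  rw [heq] at h
  have hz : 3 ∣ z := by
    obtain h | h := h3.dvd_or_dvd h
    · norm_num at h
    · exact h3.dvd_of_dvd_pow h
  have h9 : 9 ∣ x ^ 3 + 11 * y ^ 3 := by
    rw [heq]
    refine Dvd.dvd.mul_left ?_ _
    exact (show (9 : ℤ) ∣ 3 ^ 11 by norm_num).trans (pow_dvd_pow_of_dvd hz 11)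
  have key : ∀ a b : ZMod 9, a ^ 3 + 11 * b ^ 3 = 0 → 3 * a = 0 ∧ 3 * b = 0 := by decide
  have := key x y (by exact_mod_cast (ZMod.intCast_zmod_eq_zero_iff_dvd _ 9).2 h9)
  have hx := (ZMod.intCast_zmod_eq_zero_iff_dvd (3 * x) 9).1 (by exact_mod_cast this.1)
  have hy := (ZMod.intCast_zmod_eq_zero_iff_dvd (3 * y) 9).1 (by exact_mod_cast this.2)
  have cancel {a : ℤ} (ha : 9 ∣ 3 * a) : 3 ∣ a :=
    (mul_dvd_mul_iff_left (show (3 : ℤ) ≠ 0 by norm_num)).1 ha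
  exact h3.not_isUnit (hxy.isUnit_of_dvd' (cancel hx) (cancel hy))

theorem not_dvd_eleven {x y z : ℤ} (hxy : IsCoprime x y)
    (heq : x ^ 3 + 11 * y ^ 3 = 1000121 ^ 6 * z ^ 11) : ¬ 11 ∣ x := by
  rintro ⟨a, rfl⟩
  have h11 : Prime (11 : ℤ) := by norm_num
  have hz : 11 ∣ z := by
    have : 11 ∣ 1000121 ^ 6 * z ^ 11 := heq ▸ ⟨11 ^ 2 * a ^ 3 + y ^ 3, by ring⟩
    obtain h | h := h11.dvd_or_dvd this
    · norm_num at h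
    · exact h11.dvd_of_dvd_pow h
  obtain ⟨c, rfl⟩ := hz
  have hy : 11 ∣ y := by
    refine h11.dvd_of_dvd_pow (n := 3) ⟨1000121 ^ 6 * 11 ^ 9 * c ^ 11 - 11 * a ^ 3, ?_⟩
    apply mul_left_cancel₀ (show (11 : ℤ) ≠ 0 by norm_num)
    linear_combination heq
  exact h11.not_isUnit (hxy.isUnit_of_dvd' ⟨a, rfl⟩ hy)

theorem isCoprime_of_not_dvd {x y z : ℤ} (hgcd : Int.gcd x (Int.gcd y z) = 1)
    (heq : x ^ 3 + 11 * y ^ 3 = 1000121 ^ 6 * z ^ 11) (hx : ¬ 1000121 ∣ x) : IsCoprime x y := by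
  refine isCoprime_of_prime_dvd ?_ fun q hq hqx hqy ↦ ?_
  · rintro ⟨rfl, -⟩
    simp at hx
  have hp : Prime (1000121 : ℤ) := by norm_num
  have hdvd : q ∣ 1000121 ^ 6 * z ^ 11 := heq ▸
    dvd_add (dvd_pow hqx (by norm_num)) (Dvd.dvd.mul_left (dvd_pow hqy (by norm_num)) _)
  obtain h | h := hq.dvd_or_dvd hdvd
  · exact hx (((hq.dvd_prime_iff_associated hp).1 (hq.dvd_of_dvd_pow h)).symm.dvd.trans hqx)
  · have : q ∣ Int.gcd x (Int.gcd y z) :=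
      Int.dvd_coe_gcd hqx (Int.dvd_coe_gcd hqy (hq.dvd_of_dvd_pow h))
    rw [hgcd] at this
    exact hq.not_isUnit (isUnit_of_dvd_one (by simpa using this))

end IsCubicGenerator

end

/-- Every primitive integer solution of `x³ + 11y³ = 1000121⁶ z¹¹` satisfies
`x ≡ y ≡ 0 (mod 1000121)`. -/
theorem fermat_descent_deg11 :
    ∀ x y z : ℤ, Int.gcd x (Int.gcd y z) = 1 →
      x ^ 3 + 11 * y ^ 3 = 1000121 ^ 6 * z ^ 11 →
      (1000121 : ℤ) ∣ x ∧ (1000121 : ℤ) ∣ y := by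
  intro x y z hgcd heq
  have hp : Prime (1000121 : ℤ) := by norm_num
  have hdvd : 1000121 ∣ x ^ 3 + 11 * y ^ 3 :=
    heq ▸ Dvd.dvd.mul_right (dvd_pow_self _ (by norm_num)) _
  by_cases hx : 1000121 ∣ x
  · have hy := (dvd_add_right (dvd_pow hx three_ne_zero)).1 hdvd
    obtain hy | hy := hp.dvd_or_dvd hy
    · norm_num at hy
    · exact ⟨hx, hp.dvd_of_dvd_pow hy⟩
  exfalso
  obtain ⟨θ, b, hθ, hb⟩ := exists_integral_pow_basis_cubicField
  have h := IsCubicGenerator.of_basis hθ b hb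
  have hdisc := IsCubicGenerator.discr_eq hθ b hb
  have hrank := IsCubicGenerator.finrank_eq_three b
  have hxy := IsCubicGenerator.isCoprime_of_not_dvd hgcd heq hx
  have hx11 := IsCubicGenerator.not_dvd_eleven hxy heq
  have : Fact (Nat.Prime 1000121) := ⟨by norm_num⟩
  obtain ⟨α, β, hα, hαβ, hz⟩ := IsCubicGenerator.exists_factorization hθ heq
    (IsCubicGenerator.dvd_hundred_mul_sub (p := 1000121) (k := 666747) (by norm_num) (by norm_num)
      hdvd)
    (IsCubicGenerator.isCoprime_linear_quadratic hθ hxy hx11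
      (IsCubicGenerator.not_dvd_three hxy heq))
  have hα0 : α ≠ 0 := by
    rintro rfl
    refine hx11 (h.dvd_of_dvd 11 x y 0 ?_).1
    rw [hα]
    simp
  obtain ⟨I, hI⟩ := IsCubicGenerator.exists_span_eq_pow hαβ hz
  obtain ⟨u, w, rfl⟩ := h.exists_eq_unit_mul_pow_eleven hdisc hrank hα0 hI
  obtain ⟨η, hη⟩ := IsCubicGenerator.exists_unit_eq_neg_one_pow_mul hdisc hrank
  have hη_sq (u : (NumberField.RingOfIntegers CubicField)ˣ) : ∃ n : ℤ, u ^ 2 = η ^ n := by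
    obtain ⟨n, rfl | rfl⟩ := hη u
    · exact ⟨n * 2, by rw [zpow_mul, zpow_ofNat]⟩
    · exact ⟨n * 2, by rw [neg_sq, zpow_mul, zpow_ofNat]⟩
  obtain ⟨r, v, rfl⟩ := IsCubicGenerator.exists_eq_pow_mul_pow_eleven hη_sq h.unit_ne_pow_eleven u
  refine h.not_linear_eq (y := y) hx11 r (v * w) ?_
  rw [hα]
  push_cast
  ring
end
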